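/- arXiv:1302.0359 — 2 statements merged into one kernel-verified Lean document; each statement's English description precedes it below -/
import Mathlib

section
/- Let m ≥ 1 be an integer and let q be a power of 2. Then M_m(q) = max{ L_{m,q}(m', ℘) : m' ∈ {0, ..., m} and ℘ a signed partition of m - m' }. -/
/-- `Mm m q` is the function `M_m(q)` from Definition 1.2 of the paper. -/
def Mm (m q : ℕ) : ℕ :=
  if q = 2 then
    -- `L` is the largest positive integer `ℓ` with `2^ℓ - 1 ≤ m`
    let L := Nat.findGreatest (fun l => 0 < l ∧ 2 ^ l - 1 ≤ m) m
    let m0 := m - (2 ^ L - 1)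
    if m0 ≤ 3 then q ^ m0 * (q ^ 2 ^ L - 1)
    else if m0 < 2 ^ (L - 1) then
      if Odd m0 then (q ^ (2 ^ (L - 1) + m0) - 1) * (q ^ 2 ^ (L - 1) - 1)
      else q * (q ^ (2 ^ (L - 1) + m0 - 1) - 1) * (q ^ 2 ^ (L - 1) - 1)
    else if m0 = 2 ^ (L - 1) then (q ^ 2 ^ L + 1) * (q ^ 2 ^ (L - 1) - 1)
    else if Odd m0 then (q ^ m0 - 1) * (q ^ 2 ^ L - 1)
    else q * (q ^ (m0 - 1) - 1) * (q ^ 2 ^ L - 1)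
  else if Odd m then
    -- the product of `q^(2^i) + 1` over the summands `2^i` of the 2-adic expansion of `m`
    ∏ i ∈ Finset.range (m + 1), if m.testBit i then q ^ 2 ^ i + 1 else 1
  else if m = 2 then q ^ 2 + 1
  else
    -- `L` is the largest positive integer `ℓ` with `2^ℓ + 2^(ℓ-1) ≤ m`
    let L := Nat.findGreatest (fun l => 0 < l ∧ 2 ^ l + 2 ^ (l - 1) ≤ m) m
    (q ^ (m - 2 ^ L + 1) - 1) * (q ^ 2 ^ L - 1) / (q - 1)

/-- A signed partition of `n`: a list of parts `(d, ε)` with `d > 0`, where `ε = true`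
encodes sign `+1` and `ε = false` encodes sign `-1`, the `d`'s summing to `n`. -/
def IsSignedPartition (n : ℕ) (P : List (ℕ × Bool)) : Prop :=
  (∀ p ∈ P, 0 < p.1) ∧ (P.map Prod.fst).sum = n

/-- The value `q^d - ε` associated to a signed part `(d, ε)`. -/
def partVal (q : ℕ) (p : ℕ × Bool) : ℕ :=
  if p.2 then q ^ p.1 - 1 else q ^ p.1 + 1

/-- `L_{m,q}(m', ℘) = 2^⌈log₂(2m')⌉ · lcm(q^{d₁} - ε₁, …, q^{d_ℓ} - ε_ℓ)`, with the
conventions that the power of two is `1` when `m' = 0` and the empty lcm is `1`. -/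
def Lfun (q mp : ℕ) (P : List (ℕ × Bool)) : ℕ :=
  2 ^ Nat.clog 2 (2 * mp) * (P.map (partVal q)).foldr Nat.lcm 1

section Helpers

/-- the lcm of a list of values -/
def lcmL (l : List ℕ) : ℕ := l.foldr Nat.lcm 1

lemma lcmL_cons (a : ℕ) (l : List ℕ) : lcmL (a :: l) = Nat.lcm a (lcmL l) := rfl

lemma lcmL_dvd_iff (l : List ℕ) (n : ℕ) : lcmL l ∣ n ↔ ∀ a ∈ l, a ∣ n := by
  induction l with
  | nil => simp [lcmL]
  | cons a l ih => rw [lcmL_cons, Nat.lcm_dvd_iff, ih]; simp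

lemma dvd_lcmL {l : List ℕ} {a : ℕ} (h : a ∈ l) : a ∣ lcmL l :=
  (lcmL_dvd_iff l _).1 dvd_rfl a h

lemma lcmL_pos {l : List ℕ} (h : ∀ a ∈ l, 0 < a) : 0 < lcmL l := by
  induction l with
  | nil => simp [lcmL]
  | cons a l ih =>
    rw [lcmL_cons]
    exact Nat.lcm_pos (h a (by simp)) (ih fun b hb => h b (by simp [hb]))

lemma lcm_le_mul (a b : ℕ) (ha : 0 < a) (hb : 0 < b) : Nat.lcm a b ≤ a * b :=
  Nat.le_of_dvd (Nat.mul_pos ha hb) (Nat.lcm_dvd_mul a b)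

lemma lcm_mul_le {a b c : ℕ} (ha : 0 < a) (hca : c ∣ a) (hcb : c ∣ b) :
    Nat.lcm a b * c ≤ a * b := by
  rw [← Nat.gcd_mul_lcm a b, mul_comm]
  exact Nat.mul_le_mul_right _ (Nat.le_of_dvd (Nat.gcd_pos_of_pos_left _ ha) (Nat.dvd_gcd hca hcb))

lemma lcmL_eq_prod {l : List ℕ} (h : l.Pairwise Nat.Coprime) : lcmL l = l.prod := by
  induction l with
  | nil => simp [lcmL]
  | cons a l ih =>
    rw [List.pairwise_cons] at h
    rw [lcmL_cons, ih h.2, List.prod_cons]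
    apply Nat.Coprime.lcm_eq_mul
    exact Nat.coprime_list_prod_right_iff.2 h.1

/-- `q^d-1` for even `d` splits. -/
lemma split_plus (q : ℕ) (hq : Even q) (hq0 : 0 < q) (d : ℕ) (hd : 0 < d) :
    ∃ R : List (ℕ × Bool), (∀ x ∈ R, 0 < x.1 ∧ (x.2 = true → Odd x.1)) ∧
      (R.map Prod.fst).sum = d ∧ (q ^ d - 1) ∣ lcmL (R.map (partVal q)) := by
  induction d using Nat.strong_induction_on with
  | _ d ih =>
    rcases Nat.even_or_odd' d with ⟨k, rfl | hk⟩
    · obtain ⟨R, h1, h2, h3⟩ := ih k (by omega) (by omega)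
      refine ⟨(k, false) :: R, ?_, ?_, ?_⟩
      · intro x hx
        rcases List.mem_cons.1 hx with rfl | hx
        · simp; omega
        · exact h1 x hx
      · simp [h2]; omega
      · rw [List.map_cons, lcmL_cons]
        have e : q ^ (2 * k) - 1 = (q ^ k + 1) * (q ^ k - 1) := by
          rw [← Nat.sq_sub_sq, ← pow_mul, mul_comm 2 k]
        have hev : Even (q ^ k) := hq.pow_of_ne_zero (by omega)
        have hpos : 0 < q ^ k := by positivity
        rw [e]
        apply Nat.Coprime.mul_dvd_of_dvd_of_dvd
        · have : q ^ k + 1 = (q ^ k - 1) + 2 := by omega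
          rw [this, Nat.coprime_self_add_left, Nat.coprime_two_left]
          exact Nat.Even.sub_odd hpos hev odd_one
        · exact (by simp [partVal] : q ^ k + 1 = partVal q (k, false)) ▸ Nat.dvd_lcm_left _ _
        · exact h3.trans (Nat.dvd_lcm_right _ _)
    · refine ⟨[(d, true)], ?_, by simp, ?_⟩
      · intro x hx; simp at hx; subst hx; exact ⟨hd, fun _ => ⟨k, hk⟩⟩
      · simp [lcmL, partVal]

lemma lcmL_append (a b : List ℕ) : lcmL (a ++ b) = Nat.lcm (lcmL a) (lcmL b) := by
  induction a with
  | nil => simp [lcmL]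
  | cons x a ih => rw [List.cons_append, lcmL_cons, ih, lcmL_cons, Nat.lcm_assoc]

lemma partVal_pos (q : ℕ) (hq : 2 ≤ q) (x : ℕ × Bool) (hx : 0 < x.1) : 0 < partVal q x := by
  unfold partVal
  split_ifs
  · have := Nat.one_lt_pow hx.ne' (show 1 < q by omega)
    omega
  · omega

/-- separate a signed partition in odd plus parts and minus parts. -/
lemma separate (q : ℕ) (hq : Even q) (hq2 : 2 ≤ q) (P : List (ℕ × Bool))
    (hP : ∀ x ∈ P, 0 < x.1) :
    ∃ D F : List ℕ, (∀ d ∈ D, Odd d) ∧ (∀ e ∈ F, 0 < e) ∧ D.sum + F.sum = (P.map Prod.fst).sum ∧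
      lcmL (P.map (partVal q)) ∣
        lcmL (D.map fun d => q ^ d - 1) * lcmL (F.map fun e => q ^ e + 1) := by
  -- first the case with odd plus parts
  have key : ∀ P : List (ℕ × Bool), (∀ x ∈ P, 0 < x.1 ∧ (x.2 = true → Odd x.1)) →
    ∃ D F : List ℕ, (∀ d ∈ D, Odd d) ∧ (∀ e ∈ F, 0 < e) ∧ D.sum + F.sum = (P.map Prod.fst).sum ∧
      lcmL (P.map (partVal q)) ∣
        lcmL (D.map fun d => q ^ d - 1) * lcmL (F.map fun e => q ^ e + 1) := by
    intro P hP
    induction P with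
    | nil => exact ⟨[], [], by simp, by simp, by simp, by simp [lcmL]⟩
    | cons x P ih =>
      obtain ⟨D, F, h1, h2, h3, h4⟩ := ih fun y hy => hP y (by simp [hy])
      have hx := hP x (by simp)
      obtain ⟨d, b⟩ := x
      cases b
      · refine ⟨D, d :: F, h1, ?_, ?_, ?_⟩
        · intro e he
          rcases List.mem_cons.1 he with rfl | he
          · exact hx.1
          · exact h2 e he
        · simp; omega
        · rw [List.map_cons, List.map_cons, lcmL_cons, lcmL_cons]
          apply Nat.lcm_dvd
          · apply Dvd.dvd.mul_left
            simpa [partVal] using Nat.dvd_lcm_left (q ^ d + 1) _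
          · exact h4.trans (Nat.mul_dvd_mul_left _ (Nat.dvd_lcm_right _ _))
      · refine ⟨d :: D, F, ?_, h2, ?_, ?_⟩
        · intro e he
          rcases List.mem_cons.1 he with rfl | he
          · exact hx.2 rfl
          · exact h1 e he
        · simp; omega
        · rw [List.map_cons, List.map_cons, lcmL_cons, lcmL_cons]
          apply Nat.lcm_dvd
          · apply Dvd.dvd.mul_right
            simpa [partVal] using Nat.dvd_lcm_left (q ^ d - 1) _
          · exact h4.trans (Nat.mul_dvd_mul_right (Nat.dvd_lcm_right _ _) _)
  have norm : ∃ P' : List (ℕ × Bool), (∀ x ∈ P', 0 < x.1 ∧ (x.2 = true → Odd x.1)) ∧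
      (P'.map Prod.fst).sum = (P.map Prod.fst).sum ∧
      lcmL (P.map (partVal q)) ∣ lcmL (P'.map (partVal q)) := by
    induction P with
    | nil => exact ⟨[], by simp, by simp, by simp⟩
    | cons x P ih =>
      obtain ⟨P', h1, h2, h3⟩ := ih fun y hy => hP y (by simp [hy])
      have hx := hP x (by simp)
      obtain ⟨d, b⟩ := x
      have : ∃ R : List (ℕ × Bool), (∀ x ∈ R, 0 < x.1 ∧ (x.2 = true → Odd x.1)) ∧
          (R.map Prod.fst).sum = d ∧ partVal q (d, b) ∣ lcmL (R.map (partVal q)) := by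
        cases b
        · refine ⟨[(d, false)], ?_, by simp, by simp [lcmL]⟩
          intro x hx'; simp at hx'; subst hx'; simpa using hx
        · simpa [partVal] using split_plus q hq (by omega) d hx
      obtain ⟨R, r1, r2, r3⟩ := this
      refine ⟨R ++ P', ?_, ?_, ?_⟩
      · intro x hx
        rcases List.mem_append.1 hx with hx | hx
        · exact r1 x hx
        · exact h1 x hx
      · simp [r2, h2]
      · rw [List.map_append, lcmL_append, List.map_cons, lcmL_cons]
        exact Nat.lcm_dvd (r3.trans (Nat.dvd_lcm_left _ _)) (h3.trans (Nat.dvd_lcm_right _ _))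
  obtain ⟨P', h1, h2, h3⟩ := norm
  obtain ⟨D, F, a, b, c, d⟩ := key P' h1
  exact ⟨D, F, a, b, c.trans h2, h3.trans d⟩

lemma lcmL_plus_le (q : ℕ) (hq : 2 ≤ q) (D : List ℕ) (hD : ∀ d ∈ D, Odd d) :
    0 < lcmL (D.map fun d => q ^ d - 1) ∧ lcmL (D.map fun d => q ^ d - 1) ≤ q ^ D.sum ∧
    (D ≠ [] → lcmL (D.map fun d => q ^ d - 1) ≤ q ^ D.sum - 1) := by
  induction D with
  | nil => simp [lcmL]
  | cons a D ih =>
    obtain ⟨h0, h1, h2⟩ := ih fun d hd => hD d (by simp [hd])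
    have ha : 0 < a := (hD a (by simp)).pos
    have h3 := Nat.one_lt_pow ha.ne' (show 1 < q by omega)
    rw [List.map_cons, lcmL_cons, List.sum_cons, pow_add]
    have h4 := lcm_le_mul (q ^ a - 1) _ (by omega) h0
    have h5 : (q ^ a - 1) * lcmL (D.map fun d => q ^ d - 1) ≤ q ^ a * q ^ D.sum - 1 := by
      calc _ ≤ (q ^ a - 1) * q ^ D.sum := Nat.mul_le_mul_left _ h1
        _ ≤ _ := by
          rw [Nat.sub_mul]
          have : 0 < q ^ D.sum := by positivity
          omega
    refine ⟨Nat.lcm_pos (by omega) h0, by omega, fun _ => h4.trans h5⟩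

end Helpers
section Helpers2

/-- 2-adic valuation -/
abbrev nu (e : ℕ) : ℕ := padicValNat 2 e

lemma nu_decomp {e : ℕ} (he : 0 < e) : ∃ o, Odd o ∧ e = 2 ^ nu e * o := by
  obtain ⟨o, ho⟩ := pow_padicValNat_dvd (p := 2) (n := e)
  refine ⟨o, ?_, ho⟩
  by_contra h
  rw [Nat.not_odd_iff_even] at h
  obtain ⟨k, rfl⟩ := h.two_dvd
  refine pow_succ_padicValNat_not_dvd (p := 2) he.ne' ⟨k, ?_⟩
  rw [pow_succ, mul_assoc]
  exact ho

lemma two_pow_nu_le {e : ℕ} (he : 0 < e) : 2 ^ nu e ≤ e :=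
  Nat.le_of_dvd he pow_padicValNat_dvd

lemma plus_dvd (q e : ℕ) (he : 0 < e) : q ^ 2 ^ nu e + 1 ∣ q ^ e + 1 := by
  obtain ⟨o, ho, h⟩ := nu_decomp he
  have : q ^ e + 1 = (q ^ 2 ^ nu e) ^ o + 1 ^ o := by
    rw [← pow_mul, ← h, one_pow]
  rw [this]
  simpa using Odd.nat_add_dvd_pow_add_pow (q ^ 2 ^ nu e) 1 ho

lemma tail_prod (y : ℝ) (hy0 : 0 < y) (hy1 : y < 1) (k n : ℕ) :
    ∀ S : Finset ℕ, (∀ v ∈ S, k ≤ v ∧ v < k + n) →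
    (∏ v ∈ S, (1 + y ^ 2 ^ v)) * (1 - y ^ 2 ^ k) ≤ 1 - y ^ 2 ^ (k + n) := by
  induction n with
  | zero =>
    intro S hS
    have : S = ∅ := by
      apply Finset.eq_empty_of_forall_notMem
      intro v hv
      have := hS v hv
      omega
    subst this
    simp
  | succ n ih =>
    intro S hS
    have hpos : 0 < y ^ 2 ^ (k + n) := by positivity
    have hsq : y ^ 2 ^ (k + (n + 1)) = y ^ 2 ^ (k + n) * y ^ 2 ^ (k + n) := by
      rw [← pow_add, ← add_assoc, pow_succ, mul_two]
    have hlt : y ^ 2 ^ (k + n) < 1 := pow_lt_one₀ hy0.le hy1 (by positivity)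
    rw [hsq]
    by_cases h : k + n ∈ S
    · rw [← Finset.mul_prod_erase S _ h]
      have := ih (S.erase (k + n)) (by
        intro v hv
        have h1 := Finset.mem_erase.1 hv
        have := hS v h1.2
        omega)
      rw [mul_assoc]
      nlinarith
    · have := ih S (by
        intro v hv
        have h1 := hS v hv
        have : v ≠ k + n := fun h' => h (h' ▸ hv)
        omega)
      nlinarith

lemma tail_prod' (y : ℝ) (hy0 : 0 < y) (hy1 : y < 1) (k : ℕ)
    (S : Finset ℕ) (hS : ∀ v ∈ S, k ≤ v) :
    (∏ v ∈ S, (1 + y ^ 2 ^ v)) * (1 - y ^ 2 ^ k) ≤ 1 := by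
  have h := tail_prod y hy0 hy1 k (S.sup id + 1) S (by
    intro v hv
    have : v ≤ S.sup id := Finset.le_sup (f := id) hv
    exact ⟨hS v hv, by omega⟩)
  have : 0 < y ^ 2 ^ (k + (S.sup id + 1)) := by positivity
  linarith

/-- good set: positive, distinct valuations at least `k` -/
def Good (k : ℕ) (E : Finset ℕ) : Prop :=
  (∀ e ∈ E, 0 < e ∧ k ≤ nu e) ∧ Set.InjOn nu (E : Set ℕ)

lemma Good.prod_le {k : ℕ} {E : Finset ℕ} (hE : Good k E) (y : ℝ) (hy0 : 0 < y) (hy1 : y < 1) :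
    (∏ e ∈ E, (1 + y ^ e)) * (1 - y ^ 2 ^ k) ≤ 1 := by
  have h1 := tail_prod' y hy0 hy1 k (E.image nu) (by
    intro v hv
    obtain ⟨e, he, rfl⟩ := Finset.mem_image.1 hv
    exact (hE.1 e he).2)
  rw [Finset.prod_image hE.2] at h1
  have hlt : y ^ 2 ^ k < 1 := pow_lt_one₀ hy0.le hy1 (by positivity)
  refine le_trans (mul_le_mul_of_nonneg_right ?_ (by linarith)) h1
  apply Finset.prod_le_prod
  · intro e _; positivity
  · intro e he
    have := pow_le_pow_of_le_one hy0.le hy1.le (two_pow_nu_le (hE.1 e he).1)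
    linarith

lemma Good.erase {k : ℕ} {E : Finset ℕ} (hE : Good k E) {e : ℕ} (he : e ∈ E) (hk : nu e = k) :
    Good (k + 1) (E.erase e) := by
  refine ⟨?_, hE.2.mono (by simp [Finset.coe_erase])⟩
  intro x hx
  have h1 := Finset.mem_erase.1 hx
  have h2 := hE.1 x h1.2
  refine ⟨h2.1, ?_⟩
  rcases h2.2.lt_or_eq with h | h
  · exact h
  · exact absurd (hE.2 h1.2 he (by rw [← h, hk])) h1.1

lemma Good.succ {k : ℕ} {E : Finset ℕ} (hE : Good k E) (hk : ∀ e ∈ E, nu e ≠ k) :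
    Good (k + 1) E := by
  refine ⟨?_, hE.2⟩
  intro x hx
  have h2 := hE.1 x hx
  have := hk x hx
  exact ⟨h2.1, by omega⟩

lemma three_le {e k : ℕ} (he : 0 < e) (hk : nu e = k) (hne : e ≠ 2 ^ k) : 3 * 2 ^ k ≤ e := by
  obtain ⟨o, ho, h⟩ := nu_decomp he
  rw [hk] at h
  obtain ⟨c, rfl⟩ := ho
  have : c ≠ 0 := by
    rintro rfl
    simp at h
    exact hne h
  rw [h, mul_comm]
  exact Nat.mul_le_mul_left _ (by omega)

lemma Good.prod_le_of_notMem {k : ℕ} {E : Finset ℕ} (hE : Good k E) (hn : 2 ^ k ∉ E)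
    (y : ℝ) (hy0 : 0 < y) (hy1 : y < 1) :
    (∏ e ∈ E, (1 + y ^ e)) * (1 - y ^ 2 ^ k) ≤ 1 - y ^ 2 ^ k + (y ^ 2 ^ k) ^ 2 := by
  have hpos : 0 < y ^ 2 ^ k := by positivity
  have hlt : y ^ 2 ^ k < 1 := pow_lt_one₀ hy0.le hy1 (by positivity)
  have hsq : y ^ 2 ^ (k + 1) = (y ^ 2 ^ k) ^ 2 := by
    rw [← pow_mul, ← pow_succ]
  by_cases h : ∃ e ∈ E, nu e = k
  · obtain ⟨e, he, hk⟩ := h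
    have h1 := (hE.erase he hk).prod_le y hy0 hy1
    rw [← Finset.mul_prod_erase E _ he]
    have h3 : y ^ e ≤ (y ^ 2 ^ k) ^ 3 := by
      rw [← pow_mul, mul_comm]
      apply pow_le_pow_of_le_one hy0.le hy1.le
      exact three_le (hE.1 e he).1 hk (fun h => hn (h ▸ he))
    rw [hsq] at h1
    generalize y ^ 2 ^ k = z at *
    have hQ : 0 < ∏ e ∈ E.erase e, (1 + y ^ e) := Finset.prod_pos fun _ _ => by positivity
    generalize ∏ e ∈ E.erase e, (1 + y ^ e) = Q at *
    have h4 : (1 + y ^ e) * Q * (1 - z) ≤ (1 + z ^ 3) * Q * (1 - z) := by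
      apply mul_le_mul_of_nonneg_right _ (by linarith)
      apply mul_le_mul_of_nonneg_right _ hQ.le
      linarith
    have h5 : (1 + z ^ 3) * Q * (1 - z) = (1 - z + z ^ 2) * (Q * (1 - z ^ 2)) := by ring
    rw [h5] at h4
    have h6 : 0 < 1 - z + z ^ 2 := by nlinarith
    nlinarith
  · push Not at h
    have h1 := (hE.succ h).prod_le y hy0 hy1
    rw [hsq] at h1
    generalize y ^ 2 ^ k = z at *
    have hQ : 0 < ∏ e ∈ E, (1 + y ^ e) := Finset.prod_pos fun _ _ => by positivity
    generalize ∏ e ∈ E, (1 + y ^ e) = Q at *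
    have h6 : (1 - z + z ^ 2) * (Q * (1 - z ^ 2)) = Q * (1 - z) * (1 + z ^ 3) := by ring
    have h7 : 0 < 1 - z + z ^ 2 := by nlinarith
    have h8 : 0 ≤ Q * (1 - z) * z ^ 3 := by
      have : 0 < 1 - z := by linarith
      positivity
    nlinarith

lemma Good.two_le {k : ℕ} {E : Finset ℕ} (hE : Good k E) (hn : 2 ^ k ∉ E) :
    ∀ e ∈ E, 2 ^ (k + 1) ≤ e := by
  intro e he
  have h := hE.1 e he
  rcases h.2.lt_or_eq with h1 | h1
  · exact (Nat.pow_le_pow_right (by norm_num) h1).trans (two_pow_nu_le h.1)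
  · have := three_le h.1 h1.symm (fun h => hn (h ▸ he))
    rw [pow_succ]
    omega

/-- first missing power of two -/
lemma Good.first_missing {E : Finset ℕ} (hE : Good 0 E) (y : ℝ) :
    ∃ (j : ℕ) (E' : Finset ℕ), Good j E' ∧ 2 ^ j ∉ E' ∧ ∑ e ∈ E, e = 2 ^ j - 1 + ∑ e ∈ E', e ∧
      (∏ e ∈ E, (1 + y ^ e)) * (1 - y) = (1 - y ^ 2 ^ j) * ∏ e ∈ E', (1 + y ^ e) ∧
      (j = 0 → 1 ∉ E) := by
  have hex : ∃ j, 2 ^ j ∉ E := by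
    by_contra h
    push Not at h
    have : (Set.range (fun j : ℕ => 2 ^ j)).Finite :=
      E.finite_toSet.subset (by rintro _ ⟨j, rfl⟩; exact h j)
    exact Set.infinite_range_of_injective (Nat.pow_right_injective le_rfl) this
  have key : ∀ j, (∀ i < j, 2 ^ i ∈ E) → ∃ E' ⊆ E, Good j E' ∧ (∀ i, j ≤ i → 2 ^ i ∈ E → 2 ^ i ∈ E')
      ∧ ∑ e ∈ E, e = 2 ^ j - 1 + ∑ e ∈ E', e ∧
      (∏ e ∈ E, (1 + y ^ e)) * (1 - y) = (1 - y ^ 2 ^ j) * ∏ e ∈ E', (1 + y ^ e) := by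
    intro j
    induction j with
    | zero => intro _; exact ⟨E, subset_rfl, hE, fun _ _ h => h, by simp, by simp; ring⟩
    | succ j ih =>
      intro h
      obtain ⟨E', hs, g, h1, h3, h4⟩ := ih fun i hi => h i (by omega)
      have hm := h1 j le_rfl (h j (by omega))
      refine ⟨E'.erase (2 ^ j), (Finset.erase_subset _ _).trans hs, g.erase hm (by simp [nu]),
        ?_, ?_, ?_⟩
      · intro i hi hi'
        refine Finset.mem_erase.2 ⟨?_, h1 i (by omega) hi'⟩
        intro h'
        have := Nat.pow_right_injective le_rfl h'
        omega
      · rw [h3, ← Finset.add_sum_erase E' _ hm]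
        have : 0 < 2 ^ j := by positivity
        rw [pow_succ]
        omega
      · rw [h4, ← Finset.mul_prod_erase E' _ hm]
        have : y ^ 2 ^ (j + 1) = (y ^ 2 ^ j) ^ 2 := by
          rw [← pow_mul, ← pow_succ]
        rw [this]
        ring
  obtain ⟨E', hs, g, h1, h3, h4⟩ := key (Nat.find hex) (by
    intro i hi
    simpa using Nat.find_min hex hi)
  refine ⟨Nat.find hex, E', g, fun h => Nat.find_spec hex (hs h), h3, h4, ?_⟩
  intro h0
  have := Nat.find_spec hex
  rw [h0] at this
  simpa using this

lemma Good.dvd_sum {k : ℕ} {E : Finset ℕ} (hE : Good k E) : 2 ^ k ∣ ∑ e ∈ E, e := by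
  apply Finset.dvd_sum
  intro e he
  exact (Nat.pow_dvd_pow 2 (hE.1 e he).2).trans pow_padicValNat_dvd

/-- the binary expansion is optimal -/
lemma Good.prod_le_bits (y : ℝ) (hy0 : 0 < y) (hy1 : y ≤ 1 / 2) (N : ℕ) :
    ∀ (k n : ℕ) (E : Finset ℕ), Good k E → n < 2 ^ N → ∑ e ∈ E, e = 2 ^ k * n →
    ∏ e ∈ E, (1 + y ^ e) ≤ ∏ i ∈ Finset.range N, if n.testBit i then 1 + y ^ 2 ^ (k + i) else 1 := by
  induction N with
  | zero =>
    intro k n E hE hn hs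
    have hn : n = 0 := by simpa using hn
    subst hn
    have : E = ∅ := by
      apply Finset.eq_empty_of_forall_notMem
      intro e he
      have h1 := Finset.single_le_sum (f := fun e => e) (fun _ _ => Nat.zero_le _) he
      have := (hE.1 e he).1
      omega
    subst this
    simp
  | succ N ih =>
    intro k n E hE hn hs
    have hrw : ∏ i ∈ Finset.range (N + 1), (if n.testBit i then 1 + y ^ 2 ^ (k + i) else 1) =
        (∏ i ∈ Finset.range N, if (n / 2).testBit i then 1 + y ^ 2 ^ (k + 1 + i) else 1) *
          (if n % 2 = 1 then 1 + y ^ 2 ^ k else 1) := by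
      rw [Finset.prod_range_succ']
      congr 1
      · apply Finset.prod_congr rfl
        intro i _
        rw [Nat.testBit_succ, show k + (i + 1) = k + 1 + i by ring]
      · simp [Nat.testBit_zero]
    rw [hrw]
    have hge1 : 1 ≤ ∏ i ∈ Finset.range N, if (n / 2).testBit i then 1 + y ^ 2 ^ (k + 1 + i) else 1 := by
      apply Finset.prod_induction _ (fun x : ℝ => 1 ≤ x)
      · intro a b ha hb; nlinarith
      · exact le_rfl
      · intro i _
        split_ifs
        · have : 0 < y ^ 2 ^ (k + 1 + i) := by positivity
          linarith
        · exact le_rfl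
    have hz : 0 < y ^ 2 ^ k := by positivity
    have hn2 : n / 2 < 2 ^ N := by rw [pow_succ] at hn; omega
    have h2k : 0 < 2 ^ k := by positivity
    by_cases h : ∃ e ∈ E, nu e = k
    · obtain ⟨e, he, hk⟩ := h
      obtain ⟨o, ho, heo⟩ := nu_decomp (hE.1 e he).1
      rw [hk] at heo
      have hE' := hE.erase he hk
      obtain ⟨w, hw⟩ := hE'.dvd_sum
      have hsum := Finset.add_sum_erase E (fun e => e) he
      have hno : n = o + 2 * w := by
        have : 2 ^ k * n = 2 ^ k * (o + 2 * w) := by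
          rw [← hs, ← hsum, hw, mul_add, ← heo, pow_succ]; ring
        exact Nat.eq_of_mul_eq_mul_left h2k this
      have hodd : n % 2 = 1 := by
        obtain ⟨c, rfl⟩ := ho
        omega
      rw [if_pos hodd]
      by_cases he2 : e = 2 ^ k
      · have ho1 : o = 1 := by
          have : 2 ^ k * o = 2 ^ k * 1 := by rw [← heo, he2, mul_one]
          exact Nat.eq_of_mul_eq_mul_left h2k this
        have hw' : w = n / 2 := by omega
        have := ih (k + 1) (n / 2) (E.erase e) hE' hn2 (by rw [hw, hw'])
        rw [← Finset.mul_prod_erase E _ he, mul_comm, he2]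
        apply mul_le_mul_of_nonneg_right _ (by positivity)
        rw [← he2]
        exact this
      · have h1 := hE.prod_le_of_notMem (by
          intro h2
          exact he2 (hE.2 he h2 (by rw [hk]; simp [nu]))) y hy0 (by linarith)
        have hzle : y ^ 2 ^ k ≤ 1 / 2 :=
          (pow_le_of_le_one hy0.le (by linarith) (by positivity)).trans hy1
        have h3 : ∏ e ∈ E, (1 + y ^ e) ≤ 1 + y ^ 2 ^ k := by
          by_contra h4
          push Not at h4
          nlinarith
        nlinarith
    · push Not at h
      have hE' := hE.succ h
      obtain ⟨w, hw⟩ := hE'.dvd_sum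
      have hnw : n = 2 * w := by
        have : 2 ^ k * n = 2 ^ k * (2 * w) := by
          rw [← hs, hw, pow_succ]; ring
        exact Nat.eq_of_mul_eq_mul_left h2k this
      rw [if_neg (by omega), mul_one]
      exact ih (k + 1) (n / 2) E hE' hn2 (by rw [hw, show n / 2 = w by omega])

/-- bound for minus parts -/
lemma minus_bound (q : ℕ) (hq : 2 ≤ q) (F : List ℕ) (hF : ∀ e ∈ F, 0 < e) :
    (lcmL (F.map fun e => q ^ e + 1) : ℝ) * (q : ℝ)⁻¹ ^ F.sum ≤
      ∏ v ∈ (F.map nu).toFinset, (1 + (q : ℝ)⁻¹ ^ 2 ^ v) ∧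
    (¬ (F.map nu).Nodup → (lcmL (F.map fun e => q ^ e + 1) : ℝ) * (q : ℝ)⁻¹ ^ F.sum ≤
      (q : ℝ)⁻¹ * ∏ v ∈ (F.map nu).toFinset, (1 + (q : ℝ)⁻¹ ^ 2 ^ v)) := by
  have hq0 : (0 : ℝ) < q := by positivity
  set y : ℝ := (q : ℝ)⁻¹ with hy
  have hy0 : 0 < y := by positivity
  have hyq : ∀ n : ℕ, y ^ n * (q : ℝ) ^ n = 1 := by
    intro n
    rw [← mul_pow, hy, inv_mul_cancel₀ hq0.ne', one_pow]
  have hy1 : y < 1 := inv_lt_one_of_one_lt₀ (by exact_mod_cast hq)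
  induction F with
  | nil => simp [lcmL]
  | cons a F ih =>
    obtain ⟨h1, h2⟩ := ih fun e he => hF e (by simp [he])
    have ha := hF a (by simp)
    have hBpos : 0 < lcmL (F.map fun e => q ^ e + 1) := lcmL_pos (by
      intro x hx
      obtain ⟨e, _, rfl⟩ := List.mem_map.1 hx
      omega)
    simp only [List.map_cons, List.toFinset_cons, List.sum_cons]
    rw [lcmL_cons]
    by_cases hmem : nu a ∈ F.map nu
    · rw [Finset.insert_eq_of_mem (by simpa using hmem)]
      obtain ⟨b, hb, hab⟩ := List.mem_map.1 hmem
      have hdb : q ^ 2 ^ nu a + 1 ∣ lcmL (F.map fun e => q ^ e + 1) := by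
        rw [← hab]
        exact (plus_dvd q b (hF b (by simp [hb]))).trans
          (dvd_lcmL (List.mem_map.2 ⟨b, hb, rfl⟩))
      have h3 := lcm_mul_le (Nat.succ_pos _) (plus_dvd q a ha) hdb
      have h3' : ((Nat.lcm (q ^ a + 1) (lcmL (F.map fun e => q ^ e + 1)) : ℕ) : ℝ) *
          ((q : ℝ) ^ 2 ^ nu a + 1) ≤ ((q : ℝ) ^ a + 1) * (lcmL (F.map fun e => q ^ e + 1) : ℕ) := by
        exact_mod_cast h3
      have h4 : y ^ a ≤ y ^ 2 ^ nu a := pow_le_pow_of_le_one hy0.le hy1.le (two_pow_nu_le ha)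
      have h5 : y ^ 2 ^ nu a ≤ y := pow_le_of_le_one hy0.le hy1.le (by positivity)
      have e1 := hyq a
      have e2 := hyq (2 ^ nu a)
      have h6 : ((Nat.lcm (q ^ a + 1) (lcmL (F.map fun e => q ^ e + 1)) : ℕ) : ℝ) * y ^ (a + F.sum)
          ≤ y * ((lcmL (F.map fun e => q ^ e + 1) : ℕ) * y ^ F.sum) := by
        have hB' : (0:ℝ) < (lcmL (F.map fun e => q ^ e + 1) : ℕ) := by exact_mod_cast hBpos
        generalize ((Nat.lcm (q ^ a + 1) (lcmL (F.map fun e => q ^ e + 1)) : ℕ) : ℝ) = X at *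
        generalize ((lcmL (F.map fun e => q ^ e + 1) : ℕ) : ℝ) = B at *
        have hX : X * y ^ a ≤ y * B := by
          have hz : 0 < y ^ 2 ^ nu a := by positivity
          generalize y ^ 2 ^ nu a = z at *
          have hw : 0 < y ^ a := by positivity
          generalize y ^ a = w at *
          have hm := mul_le_mul_of_nonneg_right h3' (mul_pos hw hz).le
          have l1 : X * ((q : ℝ) ^ 2 ^ nu a + 1) * (w * z) = X * w * (1 + z) := by
            linear_combination X * w * e2
          have l2 : ((q : ℝ) ^ a + 1) * B * (w * z) = z * B * (1 + w) := by
            linear_combination z * B * e1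
          rw [l1, l2] at hm
          have l3 : z * B * (1 + w) ≤ y * B * (1 + z) := by
            have : z * B ≤ y * B := mul_le_mul_of_nonneg_right h5 hB'.le
            apply mul_le_mul this (by linarith) (by positivity) (by positivity)
          have : X * w * (1 + z) ≤ y * B * (1 + z) := hm.trans l3
          exact le_of_mul_le_mul_right this (by linarith)
        have hS : 0 < y ^ F.sum := by positivity
        calc X * y ^ (a + F.sum) = (X * y ^ a) * y ^ F.sum := by rw [pow_add]; ring
          _ ≤ (y * B) * y ^ F.sum := mul_le_mul_of_nonneg_right hX hS.le
          _ = _ := by ring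
      have h7 : y * ((lcmL (F.map fun e => q ^ e + 1) : ℕ) * y ^ F.sum) ≤
          y * ∏ v ∈ (F.map nu).toFinset, (1 + y ^ 2 ^ v) := mul_le_mul_of_nonneg_left h1 hy0.le
      have h8 : 0 < ∏ v ∈ (F.map nu).toFinset, (1 + y ^ 2 ^ v) :=
        Finset.prod_pos fun _ _ => by positivity
      refine ⟨?_, fun _ => h6.trans h7⟩
      nlinarith
    · rw [Finset.prod_insert (by simpa using hmem)]
      have h3 := lcm_le_mul _ _ (Nat.succ_pos (q ^ a)) hBpos
      have h3' : ((Nat.lcm (q ^ a + 1) (lcmL (F.map fun e => q ^ e + 1)) : ℕ) : ℝ)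
          ≤ ((q : ℝ) ^ a + 1) * (lcmL (F.map fun e => q ^ e + 1) : ℕ) := by
        exact_mod_cast h3
      have h4 : y ^ a ≤ y ^ 2 ^ nu a := pow_le_pow_of_le_one hy0.le hy1.le (two_pow_nu_le ha)
      have e1 := hyq a
      have h6 : ((Nat.lcm (q ^ a + 1) (lcmL (F.map fun e => q ^ e + 1)) : ℕ) : ℝ) * y ^ (a + F.sum)
          ≤ (1 + y ^ 2 ^ nu a) * ((lcmL (F.map fun e => q ^ e + 1) : ℕ) * y ^ F.sum) := by
        have hB' : (0:ℝ) < (lcmL (F.map fun e => q ^ e + 1) : ℕ) := by exact_mod_cast hBpos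
        have hp : 0 < y ^ (a + F.sum) := by positivity
        have hp' : 0 < y ^ F.sum := by positivity
        calc _ ≤ ((q : ℝ) ^ a + 1) * (lcmL (F.map fun e => q ^ e + 1) : ℕ) * y ^ (a + F.sum) :=
              mul_le_mul_of_nonneg_right h3' hp.le
          _ = (1 + y ^ a) * ((lcmL (F.map fun e => q ^ e + 1) : ℕ) * y ^ F.sum) := by
              rw [pow_add]
              linear_combination ((lcmL (F.map fun e => q ^ e + 1) : ℕ) : ℝ) * y ^ F.sum * e1
          _ ≤ _ := mul_le_mul_of_nonneg_right (by linarith) (by positivity)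
      have hpos : 0 < 1 + y ^ 2 ^ nu a := by positivity
      refine ⟨h6.trans (mul_le_mul_of_nonneg_left h1 hpos.le), ?_⟩
      intro hnd
      have : ¬ (F.map nu).Nodup := by
        intro h
        exact hnd (List.nodup_cons.2 ⟨hmem, h⟩)
      refine (h6.trans (mul_le_mul_of_nonneg_left (h2 this) hpos.le)).trans (le_of_eq ?_)
      ring

end Helpers2
section Helpers3

lemma minus_prod (q : ℕ) (hq : 2 ≤ q) (F : List ℕ) :
    (lcmL (F.map fun e => q ^ e + 1) : ℝ) * (q : ℝ)⁻¹ ^ F.sum ≤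
      (F.map fun e => 1 + (q : ℝ)⁻¹ ^ e).prod := by
  have hq0 : (0 : ℝ) < q := by positivity
  induction F with
  | nil => simp [lcmL]
  | cons a F ih =>
    have hBpos : 0 < lcmL (F.map fun e => q ^ e + 1) := lcmL_pos (by
      intro x hx
      obtain ⟨e, _, rfl⟩ := List.mem_map.1 hx
      omega)
    simp only [List.map_cons, List.prod_cons, List.sum_cons]
    rw [lcmL_cons]
    have h3 := lcm_le_mul _ _ (Nat.succ_pos (q ^ a)) hBpos
    have h3' : ((Nat.lcm (q ^ a + 1) (lcmL (F.map fun e => q ^ e + 1)) : ℕ) : ℝ)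
        ≤ ((q : ℝ) ^ a + 1) * (lcmL (F.map fun e => q ^ e + 1) : ℕ) := by
      exact_mod_cast h3
    have e1 : (q : ℝ)⁻¹ ^ a * (q : ℝ) ^ a = 1 := by
      rw [← mul_pow, inv_mul_cancel₀ hq0.ne', one_pow]
    calc _ ≤ ((q : ℝ) ^ a + 1) * (lcmL (F.map fun e => q ^ e + 1) : ℕ) * (q : ℝ)⁻¹ ^ (a + F.sum) :=
          mul_le_mul_of_nonneg_right h3' (by positivity)
      _ = (1 + (q : ℝ)⁻¹ ^ a) * ((lcmL (F.map fun e => q ^ e + 1) : ℕ) * (q : ℝ)⁻¹ ^ F.sum) := by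
          rw [pow_add]
          linear_combination ((lcmL (F.map fun e => q ^ e + 1) : ℕ) : ℝ) * (q : ℝ)⁻¹ ^ F.sum * e1
      _ ≤ _ := mul_le_mul_of_nonneg_left ih (by positivity)

lemma list_sum_odd_parity (D : List ℕ) (hD : ∀ d ∈ D, Odd d) : D.sum % 2 = D.length % 2 := by
  induction D with
  | nil => simp
  | cons a D ih =>
    have h := ih fun d hd => hD d (by simp [hd])
    obtain ⟨c, hc⟩ := hD a (by simp)
    simp only [List.sum_cons, List.length_cons]
    omega

lemma plus_info (q : ℕ) (hq : 2 ≤ q) (D : List ℕ) (hD : ∀ d ∈ D, Odd d) (a : ℝ)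
    (ha : a = (lcmL (D.map fun d => q ^ d - 1) : ℝ) * (q : ℝ)⁻¹ ^ D.sum) :
    0 ≤ a ∧ a ≤ 1 ∧
    (D.sum = 0 ∨ (∃ d, Odd d ∧ d ≤ D.sum ∧ a ≤ 1 - (q : ℝ)⁻¹ ^ d ∧ (q ≠ 2 → d = D.sum)) ∨
      (q ≠ 2 ∧ a * (q - 1) ≤ 1)) := by
  have hq0 : (0 : ℝ) < q := by positivity
  have hqr : (2 : ℝ) ≤ q := by exact_mod_cast hq
  have hyq : ∀ n : ℕ, (q : ℝ)⁻¹ ^ n * (q : ℝ) ^ n = 1 := by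
    intro n
    rw [← mul_pow, inv_mul_cancel₀ hq0.ne', one_pow]
  obtain ⟨h0, h1, h2⟩ := lcmL_plus_le q hq D hD
  have e := hyq D.sum
  have hp : 0 < (q : ℝ)⁻¹ ^ D.sum := by positivity
  refine ⟨by rw [ha]; positivity, ?_, ?_⟩
  · have : (lcmL (D.map fun d => q ^ d - 1) : ℝ) ≤ (q : ℝ) ^ D.sum := by exact_mod_cast h1
    rw [ha]
    nlinarith
  -- the two-element bound
  have two : ∀ b c R, D = b :: c :: R →
      lcmL (D.map fun d => q ^ d - 1) * (q - 1) ≤ q ^ D.sum ∧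
      lcmL (D.map fun d => q ^ d - 1) + q ≤ q ^ D.sum := by
    rintro b c R rfl
    have hb : Odd b := hD b (by simp)
    have hc : Odd c := hD c (by simp)
    obtain ⟨r0, r1, -⟩ := lcmL_plus_le q hq R (fun d hd => hD d (by simp [hd]))
    obtain ⟨s0, s1, s2⟩ := lcmL_plus_le q hq (c :: R) (fun d hd => hD d (by
      rcases List.mem_cons.1 hd with rfl | h
      · simp
      · simp [h]))
    have s2 := s2 (by simp)
    have hbq : q ≤ q ^ b := Nat.le_self_pow hb.pos.ne' q
    constructor
    · simp only [List.map_cons, lcmL_cons, List.sum_cons]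
      rw [← Nat.lcm_assoc]
      have hcq : q ≤ q ^ c := Nat.le_self_pow hc.pos.ne' q
      have hbp : 0 < q ^ b - 1 := by omega
      have hcp : 0 < q ^ c - 1 := by omega
      have k1 := lcm_le_mul _ _ (Nat.lcm_pos hbp hcp) r0
      have k2 : Nat.lcm (q ^ b - 1) (q ^ c - 1) * (q - 1) ≤ (q ^ b - 1) * (q ^ c - 1) :=
        lcm_mul_le hbp (by simpa using Nat.sub_dvd_pow_sub_pow q 1 b)
          (by simpa using Nat.sub_dvd_pow_sub_pow q 1 c)
      have k3 : (q ^ b - 1) * (q ^ c - 1) ≤ q ^ b * q ^ c := Nat.mul_le_mul (by omega) (by omega)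
      calc _ ≤ Nat.lcm (q ^ b - 1) (q ^ c - 1) * lcmL (R.map fun d => q ^ d - 1) * (q - 1) :=
            Nat.mul_le_mul_right _ k1
        _ = Nat.lcm (q ^ b - 1) (q ^ c - 1) * (q - 1) * lcmL (R.map fun d => q ^ d - 1) := by ring
        _ ≤ q ^ b * q ^ c * q ^ R.sum := Nat.mul_le_mul (k2.trans k3) r1
        _ = _ := by rw [pow_add, pow_add]; ring
    · rw [List.map_cons, lcmL_cons, List.sum_cons, pow_add]
      have hS : q ≤ q ^ (c :: R).sum := Nat.le_self_pow (by
        have := hc.pos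
        simp; omega) q
      have k1 := lcm_le_mul (q ^ b - 1) _ (by omega) s0
      have k2 := k1.trans (Nat.mul_le_mul_left _ s2)
      generalize q ^ (c :: R).sum = T at *
      generalize q ^ b = U at *
      obtain ⟨u, rfl⟩ : ∃ u, U = u + 1 := ⟨U - 1, by omega⟩
      obtain ⟨t, rfl⟩ : ∃ t, T = t + 1 := ⟨T - 1, by omega⟩
      simp only [Nat.add_sub_cancel] at k2 ⊢
      nlinarith
  rcases D with _ | ⟨b, _ | ⟨c, R⟩⟩
  · left; simp
  · right; left
    refine ⟨b, hD b (by simp), by simp, ?_, by simp⟩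
    have h2 := h2 (by simp)
    have hb : 1 ≤ q ^ b := Nat.one_le_pow _ _ (by omega)
    simp only [List.sum_cons, List.sum_nil, add_zero] at *
    have : (lcmL ([b].map fun d => q ^ d - 1) : ℝ) ≤ (q : ℝ) ^ b - 1 := by
      have : lcmL ([b].map fun d => q ^ d - 1) + 1 ≤ q ^ b := by omega
      have : (lcmL ([b].map fun d => q ^ d - 1) : ℝ) + 1 ≤ (q : ℝ) ^ b := by exact_mod_cast this
      linarith
    rw [ha]
    nlinarith
  · obtain ⟨t1, t2⟩ := two b c R rfl
    generalize hDD : b :: c :: R = D at *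
    by_cases h : q = 2
    · right; left
      have hpos : 2 ≤ D.sum := by
        have := (hD b (by simp [← hDD])).pos
        have := (hD c (by simp [← hDD])).pos
        simp [← hDD]; omega
      have hne : D ≠ [] := by simp [← hDD]
      rcases Nat.even_or_odd D.sum with hev | hodd
      · refine ⟨D.sum - 1, Nat.Even.sub_odd (by omega) hev odd_one, by omega, ?_, by simp [h]⟩
        have k : (lcmL (D.map fun d => q ^ d - 1) : ℝ) + q ≤ (q : ℝ) ^ D.sum := by exact_mod_cast t2
        have e2 : (q : ℝ)⁻¹ ^ D.sum * q = (q : ℝ)⁻¹ ^ (D.sum - 1) := by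
          conv_lhs => rw [show D.sum = D.sum - 1 + 1 by omega, pow_succ]
          field_simp
        rw [ha]
        nlinarith
      · refine ⟨D.sum, hodd, le_rfl, ?_, by simp⟩
        have k : (lcmL (D.map fun d => q ^ d - 1) : ℝ) + q ≤ (q : ℝ) ^ D.sum := by exact_mod_cast t2
        rw [ha]
        nlinarith
    · right; right
      refine ⟨h, ?_⟩
      have k : (lcmL (D.map fun d => q ^ d - 1) : ℝ) * (q - 1) ≤ (q : ℝ) ^ D.sum := by
        have : (((q - 1 : ℕ)) : ℝ) = q - 1 := by rw [Nat.cast_sub (by omega)]; simp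
        rw [← this]
        exact_mod_cast t1
      rw [ha]
      nlinarith

lemma minus_info (q : ℕ) (hq : 2 ≤ q) (F : List ℕ) (hF : ∀ d ∈ F, 0 < d) (b : ℝ)
    (hb : b = (lcmL (F.map fun d => q ^ d + 1) : ℝ) * (q : ℝ)⁻¹ ^ F.sum) :
    0 ≤ b ∧ b * (1 - (q : ℝ)⁻¹) ≤ 1 ∧
    ((∃ E : Finset ℕ, Good 0 E ∧ ∑ e ∈ E, e = F.sum ∧ b ≤ ∏ e ∈ E, (1 + (q : ℝ)⁻¹ ^ e)) ∨
      b * (q - 1) ≤ 1) := by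
  have hq0 : (0 : ℝ) < q := by positivity
  have hqr : (2 : ℝ) ≤ q := by exact_mod_cast hq
  have hy0 : 0 < (q : ℝ)⁻¹ := by positivity
  have hy1 : (q : ℝ)⁻¹ < 1 := inv_lt_one_of_one_lt₀ (by linarith)
  have hyq : (q : ℝ)⁻¹ * q = 1 := inv_mul_cancel₀ hq0.ne'
  obtain ⟨h1, h2⟩ := minus_bound q hq F hF
  rw [← hb] at h1 h2
  have h3 := tail_prod' (q : ℝ)⁻¹ hy0 hy1 0 (F.map nu).toFinset (by simp)
  simp only [pow_zero, pow_one] at h3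
  refine ⟨by rw [hb]; positivity, ?_, ?_⟩
  · nlinarith
  by_cases hnd : (F.map nu).Nodup
  · left
    have hF' : F.Nodup := List.Nodup.of_map _ hnd
    refine ⟨F.toFinset, ⟨?_, ?_⟩, ?_, ?_⟩
    · intro e he
      exact ⟨hF e (by simpa using he), Nat.zero_le _⟩
    · intro x hx z hz hxz
      exact List.inj_on_of_nodup_map hnd (by simpa using hx) (by simpa using hz) hxz
    · rw [List.sum_toFinset _ hF']; simp
    · rw [List.prod_toFinset _ hF', hb]
      exact minus_prod q hq F
  · right
    have h4 := h2 hnd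
    have h5 : b * (q - 1) ≤ ((q : ℝ)⁻¹ * ∏ v ∈ (F.map nu).toFinset, (1 + (q : ℝ)⁻¹ ^ 2 ^ v)) * (q - 1) :=
      mul_le_mul_of_nonneg_right h4 (by linarith)
    refine h5.trans (le_trans (le_of_eq ?_) h3)
    linear_combination (∏ v ∈ (F.map nu).toFinset, (1 + (q : ℝ)⁻¹ ^ 2 ^ v)) * hyq

lemma clog_factor_two (mp : ℕ) : (2 : ℝ) ^ Nat.clog 2 (2 * mp) * (2 : ℝ)⁻¹ ^ mp ≤ 1 ∧
    (4 ≤ mp → (2 : ℝ) ^ Nat.clog 2 (2 * mp) * (2 : ℝ)⁻¹ ^ mp ≤ 1 / 2) := by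
  have e : (2 : ℝ)⁻¹ ^ mp * 2 ^ mp = 1 := by rw [← mul_pow]; norm_num
  have hp : (0 : ℝ) < (2 : ℝ)⁻¹ ^ mp := by positivity
  have key : 4 ≤ mp → (2 : ℝ) ^ Nat.clog 2 (2 * mp) * (2 : ℝ)⁻¹ ^ mp ≤ 1 / 2 := by
    intro h
    have h1 : ∀ k, 2 * (k + 4) ≤ 2 ^ (k + 3) := by
      intro k
      induction k with
      | zero => norm_num
      | succ k ih => rw [show k + 1 + 3 = (k + 3) + 1 by ring, pow_succ]; omega
    have h2 : Nat.clog 2 (2 * mp) ≤ mp - 1 := by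
      apply Nat.clog_le_of_le_pow
      have := h1 (mp - 4)
      rwa [show mp - 4 + 4 = mp by omega, show mp - 4 + 3 = mp - 1 by omega] at this
    have h3 : (2 : ℝ) ^ Nat.clog 2 (2 * mp) ≤ 2 ^ (mp - 1) := pow_le_pow_right₀ (by norm_num) h2
    have h4 : (2 : ℝ) ^ mp = 2 ^ (mp - 1) * 2 := by
      rw [← pow_succ]; congr 1; omega
    rw [h4] at e
    nlinarith
  refine ⟨?_, key⟩
  by_cases h : 4 ≤ mp
  · linarith [key h]
  · have h2 : Nat.clog 2 (2 * mp) ≤ mp := by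
      apply Nat.clog_le_of_le_pow
      interval_cases mp <;> norm_num
    have h3 : (2 : ℝ) ^ Nat.clog 2 (2 * mp) ≤ 2 ^ mp := pow_le_pow_right₀ (by norm_num) h2
    nlinarith

lemma clog_factor_four (q : ℕ) (hq : 4 ≤ q) (mp : ℕ) :
    (2 : ℝ) ^ Nat.clog 2 (2 * mp) * (q : ℝ)⁻¹ ^ mp ≤ 1 ∧
    (mp ≠ 0 → (2 : ℝ) ^ Nat.clog 2 (2 * mp) * (q : ℝ)⁻¹ ^ mp ≤ 1 / 2) := by
  have hq0 : (0 : ℝ) < q := by positivity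
  have e : (q : ℝ)⁻¹ ^ mp * (q : ℝ) ^ mp = 1 := by
    rw [← mul_pow, inv_mul_cancel₀ hq0.ne', one_pow]
  have hp : (0 : ℝ) < (q : ℝ)⁻¹ ^ mp := by positivity
  have key : mp ≠ 0 → (2 : ℝ) ^ Nat.clog 2 (2 * mp) * (q : ℝ)⁻¹ ^ mp ≤ 1 / 2 := by
    intro h
    have h2 : Nat.clog 2 (2 * mp) ≤ 2 * mp - 1 := by
      apply Nat.clog_le_of_le_pow
      have h1 : 2 * mp - 1 < 2 ^ (2 * mp - 1) := Nat.lt_two_pow_self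
      omega
    have h3 : (2 : ℝ) ^ Nat.clog 2 (2 * mp) ≤ 2 ^ (2 * mp - 1) := pow_le_pow_right₀ (by norm_num) h2
    have h4 : (4 : ℝ) ^ mp = 2 ^ (2 * mp - 1) * 2 := by
      rw [← pow_succ, show (4 : ℝ) = 2 ^ 2 by norm_num, ← pow_mul]; congr 1; omega
    have h5 : (4 : ℝ) ^ mp ≤ (q : ℝ) ^ mp := pow_le_pow_left₀ (by norm_num) (by exact_mod_cast hq) _
    nlinarith
  refine ⟨?_, key⟩
  by_cases h : mp = 0
  · subst h; simp
  · linarith [key h]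

/-- summary of the reduction -/
lemma reduce (q : ℕ) (hq : Even q) (hq2 : 2 ≤ q) (n : ℕ) (P : List (ℕ × Bool))
    (hP : IsSignedPartition n P) :
    ∃ (p r : ℕ) (a b : ℝ), p + r = n ∧
      (((P.map (partVal q)).foldr Nat.lcm 1 : ℕ) : ℝ) * (q : ℝ)⁻¹ ^ n ≤ a * b ∧
      0 ≤ a ∧ a ≤ 1 ∧ 0 ≤ b ∧ b * (1 - (q : ℝ)⁻¹) ≤ 1 ∧
      (p = 0 ∨ (∃ d, Odd d ∧ d ≤ p ∧ a ≤ 1 - (q : ℝ)⁻¹ ^ d ∧ (q ≠ 2 → d = p)) ∨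
        (q ≠ 2 ∧ a * (q - 1) ≤ 1)) ∧
      ((∃ E : Finset ℕ, Good 0 E ∧ ∑ e ∈ E, e = r ∧ b ≤ ∏ e ∈ E, (1 + (q : ℝ)⁻¹ ^ e)) ∨
        b * (q - 1) ≤ 1) := by
  obtain ⟨D, F, hD, hF, hs, hd⟩ := separate q hq hq2 P hP.1
  rw [hP.2] at hs
  obtain ⟨a1, a2, a3⟩ := plus_info q hq2 D hD _ rfl
  obtain ⟨b1, b2, b3⟩ := minus_info q hq2 F hF _ rfl
  refine ⟨D.sum, F.sum, _, _, hs, ?_, a1, a2, b1, b2, a3, b3⟩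
  have hBpos : 0 < lcmL (F.map fun e => q ^ e + 1) := lcmL_pos (by
      intro x hx
      obtain ⟨e, _, rfl⟩ := List.mem_map.1 hx
      omega)
  have h1 := Nat.le_of_dvd (Nat.mul_pos (lcmL_plus_le q hq2 D hD).1 hBpos) hd
  have h2 : ((lcmL (P.map (partVal q)) : ℕ) : ℝ) ≤
    (lcmL (D.map fun d => q ^ d - 1) : ℕ) * (lcmL (F.map fun e => q ^ e + 1) : ℕ) := by
    exact_mod_cast h1
  change ((lcmL (P.map (partVal q)) : ℕ) : ℝ) * _ ≤ _
  rw [← hs, pow_add]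
  refine (mul_le_mul_of_nonneg_right h2 (by positivity)).trans (le_of_eq ?_)
  ring

end Helpers3
section Core

lemma Good.struct {E : Finset ℕ} (hE : Good 0 E) (y : ℝ) (hy0 : 0 < y) (hy1 : y < 1) :
    ∃ j s : ℕ, ∑ e ∈ E, e = 2 ^ j - 1 + s ∧ 2 ^ j ∣ s ∧
      (∏ e ∈ E, (1 + y ^ e)) * (1 - y) ≤ 1 - y ^ 2 ^ j + (y ^ 2 ^ j) ^ 2 ∧
      ((s = 0 ∧ (∏ e ∈ E, (1 + y ^ e)) * (1 - y) ≤ 1 - y ^ 2 ^ j) ∨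
       (2 ^ (j + 1) ≤ s ∧ (s = 2 ^ (j + 1) →
          (∏ e ∈ E, (1 + y ^ e)) * (1 - y) ≤ (1 - y ^ 2 ^ j) * (1 + (y ^ 2 ^ j) ^ 2)))) := by
  obtain ⟨j, E', g, hn, hs, hp, -⟩ := hE.first_missing y
  refine ⟨j, ∑ e ∈ E', e, hs, g.dvd_sum, ?_, ?_⟩
  · rw [hp, mul_comm]
    exact g.prod_le_of_notMem hn y hy0 hy1
  · have h2 := g.two_le hn
    rw [hp]
    rcases E'.eq_empty_or_nonempty with rfl | ⟨e, he⟩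
    · left; simp
    · right
      have hsum := Finset.add_sum_erase E' (fun e => e) he
      have hle := h2 e he
      refine ⟨by omega, ?_⟩
      intro hs2
      have hz : ∑ x ∈ E'.erase e, x = 0 := by omega
      have hemp : E'.erase e = ∅ := by
        apply Finset.eq_empty_of_forall_notMem
        intro x hx
        have h3 := h2 x (Finset.mem_of_mem_erase hx)
        have h4 := (Finset.sum_eq_zero_iff.1 hz) x hx
        have : 0 < 2 ^ (j + 1) := by positivity
        omega
      have hee : e = 2 ^ (j + 1) := by omega
      rw [← Finset.mul_prod_erase E' _ he, hemp, Finset.prod_empty, mul_one, hee]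
      rw [← pow_mul, ← pow_succ]

lemma conv_aux (y : ℝ) (hy0 : 0 < y) (hy1 : y < 1) (c e A B : ℕ) (h1 : c ≤ A) (h2 : c ≤ B)
    (h : c + e = A + B) : (1 - y ^ c) * (1 - y ^ e) ≤ (1 - y ^ A) * (1 - y ^ B) := by
  obtain ⟨α, rfl⟩ := Nat.exists_eq_add_of_le h1
  obtain ⟨β, rfl⟩ := Nat.exists_eq_add_of_le h2
  have : e = c + α + β := by omega
  subst this
  simp only [pow_add]
  have u : y ^ α ≤ 1 := pow_le_one₀ hy0.le hy1.le
  have v : y ^ β ≤ 1 := pow_le_one₀ hy0.le hy1.le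
  have w : 0 < y ^ c := by positivity
  have : 0 ≤ y ^ c * ((1 - y ^ α) * (1 - y ^ β)) :=
    mul_nonneg w.le (mul_nonneg (by linarith) (by linarith))
  nlinarith

/-- `q ≥ 4`, even `m ≥ 4`. -/
lemma core_even (y : ℝ) (hy0 : 0 < y) (hy1 : y ≤ 1 / 4) (m L p : ℕ) (hm : Even m) (hL : 1 ≤ L)
    (hL1 : 2 ^ L + 2 ^ (L - 1) ≤ m) (hL2 : m < 3 * 2 ^ L)
    (E : Finset ℕ) (hE : Good 0 E) (hs : p + ∑ e ∈ E, e = m) (a : ℝ) (ha0 : 0 ≤ a) (ha1 : a ≤ 1)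
    (hp : p = 0 ∨ (Odd p ∧ a ≤ 1 - y ^ p)) :
    a * ((∏ e ∈ E, (1 + y ^ e)) * (1 - y)) ≤ (1 - y ^ (m - 2 ^ L + 1)) * (1 - y ^ 2 ^ L) := by
  obtain ⟨l, rfl⟩ : ∃ l, L = l + 1 := ⟨L - 1, by omega⟩
  simp only [Nat.add_sub_cancel] at hL1
  have hpw : 2 ^ (l + 1) = 2 * 2 ^ l := by rw [pow_succ]; ring
  have hl0 : 1 ≤ 2 ^ l := Nat.one_le_two_pow
  set A := m - 2 ^ (l + 1) + 1 with hA
  have hA3 : 3 ≤ A := by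
    obtain ⟨c, hc⟩ := hm
    omega
  have hX0 : 0 ≤ (∏ e ∈ E, (1 + y ^ e)) * (1 - y) :=
    mul_nonneg (Finset.prod_nonneg fun _ _ => by positivity) (by linarith)
  obtain ⟨j, s, h1, h2, h3, h4⟩ := hE.struct y hy0 (by linarith)
  generalize (∏ e ∈ E, (1 + y ^ e)) * (1 - y) = X at *
  have haX : a * X ≤ X := by nlinarith
  have mono : ∀ {u v : ℕ}, u ≤ v → y ^ v ≤ y ^ u := fun h =>
    pow_le_pow_of_le_one hy0.le (by linarith) h
  have pos : ∀ u : ℕ, 0 < y ^ u := fun u => by positivity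
  rcases Nat.eq_zero_or_pos j with rfl | hj
  · simp only [pow_zero, pow_one] at h3
    have k1 : y ^ A ≤ y ^ 3 := mono hA3
    have k2 : y ^ 2 ^ (l + 1) ≤ y ^ 2 := mono (by omega)
    have k3 : (0:ℝ) ≤ y ^ A * y ^ 2 ^ (l + 1) := by positivity
    have k4 : 2 * y ^ 2 + y ^ 3 ≤ y := by nlinarith [mul_pos hy0 hy0]
    nlinarith
  · obtain ⟨i, rfl⟩ : ∃ i, j = i + 1 := ⟨j - 1, by omega⟩
    have hpi : 2 ^ (i + 1) = 2 * 2 ^ i := by rw [pow_succ]; ring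
    have hpi2 : 2 ^ (i + 1 + 1) = 4 * 2 ^ i := by rw [pow_succ, pow_succ]; ring
    have hi0 : 1 ≤ 2 ^ i := Nat.one_le_two_pow
    have hp' : Odd p ∧ a ≤ 1 - y ^ p := by
      rcases hp with hp | hp
      · exfalso
        obtain ⟨w, hw⟩ := h2
        obtain ⟨c, hc⟩ := hm
        rw [hpi, mul_assoc] at hw
        omega
      · exact hp
    have hij : i < l → 2 ^ (i + 1) ≤ 2 ^ l := fun h => Nat.pow_le_pow_right (by norm_num) h
    have hji : l < i → 2 ^ (l + 1) ≤ 2 ^ i := fun h => Nat.pow_le_pow_right (by norm_num) h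
    rcases h4 with ⟨rfl, h4⟩ | ⟨h4, -⟩
    · have hle : a * X ≤ (1 - y ^ p) * (1 - y ^ 2 ^ (i + 1)) :=
        mul_le_mul hp'.2 h4 hX0 (ha0.trans hp'.2)
      refine hle.trans ?_
      rcases lt_trichotomy i l with h | h | h
      · have := hij h
        rw [mul_comm]
        apply conv_aux y hy0 (by linarith) <;> omega
      · subst h
        have : p = A := by omega
        rw [this]
      · have := hji h
        apply conv_aux y hy0 (by linarith) <;> omega
    · have hil : i < l := by
        by_contra h
        push Not at h
        have : 2 ^ l ≤ 2 ^ i := Nat.pow_le_pow_right (by norm_num) h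
        have := hp'.1.pos
        omega
      have := hij hil
      have k1 : y ^ A ≤ y ^ (2 ^ (i + 1) + 1) := mono (by omega)
      have k2 : y ^ 2 ^ (l + 1) ≤ y ^ (2 ^ (i + 1) + 1) := mono (by omega)
      have k3 : (0:ℝ) ≤ y ^ A * y ^ 2 ^ (l + 1) := by positivity
      have e1 : y ^ (2 ^ (i + 1) + 1) = y ^ 2 ^ (i + 1) * y := pow_succ _ _
      rw [e1] at k1 k2
      have k5 : y ^ 2 ^ (i + 1) ≤ y ^ 1 := mono (by omega)
      have k6 := pos (2 ^ (i + 1))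
      generalize y ^ 2 ^ (i + 1) = z at *
      nlinarith

/-- `q ≥ 4`, `m = 2`. -/
lemma core_two (y : ℝ) (hy0 : 0 < y) (hy1 : y ≤ 1 / 4) (p : ℕ)
    (E : Finset ℕ) (hE : Good 0 E) (hs : p + ∑ e ∈ E, e = 2) (a : ℝ) (ha0 : 0 ≤ a) (ha1 : a ≤ 1)
    (hp : p = 0 ∨ (Odd p ∧ a ≤ 1 - y ^ p)) :
    a * ((∏ e ∈ E, (1 + y ^ e)) * (1 - y)) ≤ (1 - y) * (1 + y ^ 2) := by
  have hX0 : 0 ≤ (∏ e ∈ E, (1 + y ^ e)) * (1 - y) :=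
    mul_nonneg (Finset.prod_nonneg fun _ _ => by positivity) (by linarith)
  obtain ⟨j, s, h1, h2, h3, h4⟩ := hE.struct y hy0 (by linarith)
  generalize (∏ e ∈ E, (1 + y ^ e)) * (1 - y) = X at *
  have haX : a * X ≤ X := by nlinarith
  have hj : j ≤ 1 := by
    by_contra h
    push Not at h
    have : 2 ^ 2 ≤ 2 ^ j := Nat.pow_le_pow_right (by norm_num) h
    omega
  interval_cases j
  · simp only [pow_zero, zero_add, pow_one] at *
    rcases h4 with ⟨rfl, h4⟩ | ⟨h4, h5⟩
    · have : p = 2 := by omega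
      subst this
      simp at hp
      exact absurd hp.1 (by decide)
    · have := h5 (by omega)
      linarith
  · simp only [pow_one] at *
    rcases hp with rfl | ⟨hp, hp'⟩
    · omega
    · have : p = 1 := by
        obtain ⟨c, rfl⟩ := hp
        omega
      subst this
      rcases h4 with ⟨rfl, h4⟩ | ⟨h4, h5⟩
      · have hle : a * X ≤ (1 - y ^ 1) * (1 - y ^ 2) :=
          mul_le_mul hp' h4 hX0 (ha0.trans hp')
        nlinarith [mul_pos hy0 hy0]
      · norm_num at h4
        omega

/-- `q ≥ 4`, odd `m` -/
lemma core_odd (y : ℝ) (hy0 : 0 < y) (hy1 : y ≤ 1 / 4) (m p : ℕ) (hm : Odd m)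
    (E : Finset ℕ) (hE : Good 0 E) (hs : p + ∑ e ∈ E, e = m) (a : ℝ) (ha0 : 0 ≤ a) (ha1 : a ≤ 1)
    (hp : p = 0 ∨ (Odd p ∧ a ≤ 1 - y ^ p)) :
    a * (∏ e ∈ E, (1 + y ^ e)) ≤
      ∏ i ∈ Finset.range (m + 1), if m.testBit i then 1 + y ^ 2 ^ i else 1 := by
  have hQ : 0 ≤ ∏ e ∈ E, (1 + y ^ e) := Finset.prod_nonneg fun _ _ => by positivity
  have haQ : a * (∏ e ∈ E, (1 + y ^ e)) ≤ ∏ e ∈ E, (1 + y ^ e) := by nlinarith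
  refine haQ.trans ?_
  rcases hp with rfl | ⟨hp, -⟩
  · have := Good.prod_le_bits y hy0 (by linarith) (m + 1) 0 m E hE
      (Nat.lt_two_pow_self.trans (Nat.pow_lt_pow_right (by norm_num) (by omega))) (by simpa using hs)
    simpa using this
  · have h1 : 1 + y ≤ ∏ i ∈ Finset.range (m + 1), if m.testBit i then 1 + y ^ 2 ^ i else 1 := by
      rw [Finset.prod_range_succ']
      have : m.testBit 0 = true := by
        simp [Nat.testBit_zero, Nat.odd_iff.1 hm]
      simp only [this, if_true, pow_zero, pow_one]
      have h1 : 1 ≤ ∏ i ∈ Finset.range m, if m.testBit (i + 1) then 1 + y ^ 2 ^ (i + 1) else 1 := by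
        apply Finset.prod_induction _ (fun x : ℝ => 1 ≤ x)
        · intro a b ha hb; nlinarith
        · exact le_rfl
        · intro i _
          split_ifs
          · have : 0 < y ^ 2 ^ (i + 1) := by positivity
            linarith
          · exact le_rfl
      nlinarith
    refine le_trans ?_ h1
    obtain ⟨j, s, h1, h2, h3, h4⟩ := hE.struct y hy0 (by linarith)
    have hj : j = 0 := by
      by_contra hj
      obtain ⟨i, rfl⟩ : ∃ i, j = i + 1 := ⟨j - 1, by omega⟩
      obtain ⟨w, hw⟩ := h2
      obtain ⟨c, hc⟩ := hm
      obtain ⟨c', hc'⟩ := hp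
      have hi0 : 1 ≤ 2 ^ i := Nat.one_le_two_pow
      rw [pow_succ, mul_comm _ 2, mul_assoc] at hw
      rw [pow_succ] at h1
      omega
    subst hj
    simp only [pow_zero, pow_one] at h3
    by_contra h5
    push Not at h5
    nlinarith [mul_pos hy0 hy0]

set_option maxHeartbeats 2000000 in
/-- `q = 2`: collected bound. Here `h = 2^(L-1)`. -/
lemma core2 (y : ℝ) (hy : y = 1 / 2) (L m m0 mp p : ℕ) (hL : 1 ≤ L) (hm : m = 2 ^ L - 1 + m0)
    (hm0 : m0 < 2 ^ L) (hmp : mp ≤ 3)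
    (E : Finset ℕ) (hE : Good 0 E) (hs : mp + p + ∑ e ∈ E, e = m)
    (a : ℝ) (ha0 : 0 ≤ a) (ha1 : a ≤ 1)
    (hp : p = 0 ∨ ∃ d, Odd d ∧ d ≤ p ∧ a ≤ 1 - y ^ d) (X : ℝ)
    (hX : X = a * ((∏ e ∈ E, (1 + y ^ e)) * (1 - y))) :
    (m0 ≤ 3 → X ≤ 1 - y ^ 2 ^ L) ∧
    (3 < m0 → m0 < 2 ^ (L - 1) → ∀ D, Odd D → D ≤ 2 ^ (L - 1) + m0 → 2 ^ (L - 1) + m0 ≤ D + 1 →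
      X ≤ (1 - y ^ D) * (1 - y ^ 2 ^ (L - 1))) ∧
    (3 < m0 → m0 = 2 ^ (L - 1) → X ≤ (1 + y ^ 2 ^ L) * (1 - y ^ 2 ^ (L - 1))) ∧
    (3 < m0 → 2 ^ (L - 1) < m0 → ∀ D, Odd D → D ≤ m0 → m0 ≤ D + 1 →
      X ≤ (1 - y ^ D) * (1 - y ^ 2 ^ L)) := by
  have hy0 : 0 < y := by rw [hy]; norm_num
  have hy1 : y < 1 := by rw [hy]; norm_num
  obtain ⟨l, rfl⟩ : ∃ l, L = l + 1 := ⟨L - 1, by omega⟩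
  simp only [Nat.add_sub_cancel]
  have hpw : 2 ^ (l + 1) = 2 * 2 ^ l := by rw [pow_succ]; ring
  have hl0 : 1 ≤ 2 ^ l := Nat.one_le_two_pow
  have hX0 : 0 ≤ (∏ e ∈ E, (1 + y ^ e)) * (1 - y) :=
    mul_nonneg (Finset.prod_nonneg fun _ _ => by positivity) (by linarith)
  obtain ⟨j, s, h1, -, h3, h4⟩ := hE.struct y hy0 (by linarith)
  generalize (∏ e ∈ E, (1 + y ^ e)) * (1 - y) = Z at *
  have haX : X ≤ Z := by rw [hX]; nlinarith
  have mono : ∀ {u v : ℕ}, u ≤ v → y ^ v ≤ y ^ u := fun h =>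
    pow_le_pow_of_le_one hy0.le (by linarith) h
  have pos : ∀ u : ℕ, 0 < y ^ u := fun u => by positivity
  have hh2 : y ^ 2 ^ (l + 1) = (y ^ 2 ^ l) ^ 2 := by rw [← pow_mul, ← pow_succ]
  have hhalf : ∀ u : ℕ, 0 < u → y ^ u ≤ 1 / 2 := by
    intro u hu
    have := mono (show 1 ≤ u from hu)
    rw [pow_one] at this
    linarith
  have hj : j ≤ l + 1 := by
    by_contra h
    push Not at h
    have : 2 ^ (l + 2) ≤ 2 ^ j := Nat.pow_le_pow_right (by norm_num) h
    rw [pow_succ] at this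
    omega
  have hj2 : 2 ^ (j + 1) = 2 * 2 ^ j := by rw [pow_succ]; ring
  -- Bound when a plus part of size at most N is present
  have hodd : Odd (2 ^ l - 1) ∨ 2 ^ l = 1 := by
    rcases Nat.eq_zero_or_pos l with rfl | h
    · right; simp
    · left
      exact Nat.Even.sub_odd (by omega) ((by decide : Even 2).pow_of_ne_zero (by omega)) odd_one
  have hpow4 : 3 < m0 → y ^ 2 ^ l ≤ 1 / 16 := by
    intro h
    have : 4 ≤ 2 ^ l := by
      by_contra h'
      have : l < 2 := by
        by_contra h''
        exact h' (Nat.pow_le_pow_right (by norm_num) (show 2 ≤ l by omega) |>.trans' (by norm_num))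
      interval_cases l <;> omega
    have := mono this
    have e : y ^ 4 = 1 / 16 := by rw [hy]; norm_num
    linarith
  have hz0 := pos (2 ^ l)
  -- small j
  have small : j < l → 3 < m0 → X ≤ 1 - 3 * y ^ 2 ^ l := by
    intro hjl hm3
    obtain ⟨k, rfl⟩ : ∃ k, l = k + 1 := ⟨l - 1, by omega⟩
    have hzz : y ^ 2 ^ (k + 1) = (y ^ 2 ^ k) ^ 2 := by rw [← pow_mul, ← pow_succ]
    have h16 := hpow4 hm3
    rw [hzz] at h16 ⊢
    have k1 : y ^ 2 ^ k ≤ y ^ 2 ^ j := mono (Nat.pow_le_pow_right (by norm_num) (by omega))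
    have k2 := hhalf (2 ^ j) (by positivity)
    have k3 := pos (2 ^ k)
    have k4 : y ^ 2 ^ k ≤ 1 / 4 := by nlinarith
    generalize y ^ 2 ^ k = w at *
    generalize y ^ 2 ^ j = z at *
    have : 1 - z + z ^ 2 ≤ 1 - w + w ^ 2 := by nlinarith
    nlinarith
  -- j = l+1
  have big : j = l + 1 → s = 0 := by
    rintro rfl
    rcases h4 with h4 | h4
    · exact h4.1
    · omega
  have big' : j = l + 1 → 3 < m0 → ∃ d, Odd d ∧ d ≤ m0 ∧ X ≤ (1 - y ^ d) * (1 - y ^ 2 ^ (l + 1)) := by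
    intro hj' hm3
    have hs0 := big hj'
    subst hj'
    have hZ : Z ≤ 1 - y ^ 2 ^ (l + 1) := by
      rcases h4 with h4 | h4
      · exact h4.2
      · omega
    rcases hp with hp | ⟨d, hd, hdp, had⟩
    · omega
    · refine ⟨d, hd, by omega, ?_⟩
      rw [hX]
      exact mul_le_mul had hZ hX0 (ha0.trans had)
  -- j = l
  have mid : j = l → 3 < m0 → (∃ d, Odd d ∧ d ≤ 2 ^ l + m0 ∧ X ≤ (1 - y ^ d) * (1 - y ^ 2 ^ l)) ∨
      (2 ^ l ≤ m0 ∧ X ≤ 1 - y ^ 2 ^ l + (y ^ 2 ^ l) ^ 2 ∧ (m0 = 2 ^ l →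
        X ≤ (1 - y ^ 2 ^ l) * (1 + (y ^ 2 ^ l) ^ 2))) := by
    rintro rfl hm3
    rcases h4 with ⟨hs0, h4⟩ | ⟨h4, h5⟩
    · left
      rcases hp with hp | ⟨d, hd, hdp, had⟩
      · omega
      · refine ⟨d, hd, by omega, ?_⟩
        rw [hX]
        exact mul_le_mul had h4 hX0 (ha0.trans had)
    · right
      clear hp hodd big' big
      refine ⟨?_, ?_, ?_⟩
      · omega
      · linarith
      · intro h
        exact haX.trans (h5 (by omega))
  have hdouble : ∀ d, Odd d → d ≤ 2 ^ l → 1 < 2 ^ l → 2 * y ^ 2 ^ l ≤ y ^ d := by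
    intro d hd hdl hl
    have : d ≤ 2 ^ l - 1 := by
      rcases hodd with ho | ho
      · obtain ⟨c, hc⟩ := hd
        obtain ⟨c', hc'⟩ := ho
        omega
      · omega
    have h := mono this
    have e : y ^ 2 ^ l = y ^ (2 ^ l - 1) * y := by
      rw [← pow_succ]; congr 1; omega
    rw [e]
    have e2 : 2 * (y ^ (2 ^ l - 1) * y) = y ^ (2 ^ l - 1) := by rw [hy]; ring
    linarith
  have one_sub_nonneg : ∀ u : ℕ, 0 ≤ 1 - y ^ u := fun u => by
    have : y ^ u ≤ 1 := pow_le_one₀ hy0.le hy1.le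
    linarith
  refine ⟨?_, ?_, ?_, ?_⟩
  · intro hm3
    rcases Nat.lt_or_ge j (l + 1) with hlt | hge
    · have k1 : y ^ 2 ^ l ≤ y ^ 2 ^ j := mono (Nat.pow_le_pow_right (by norm_num) (by omega))
      have k2 := hhalf (2 ^ j) (by positivity)
      have k3 := hhalf (2 ^ l) (by positivity)
      rw [hh2]
      generalize y ^ 2 ^ l = w at *
      generalize y ^ 2 ^ j = z at *
      have : 1 - z + z ^ 2 ≤ 1 - w + w ^ 2 := by nlinarith
      nlinarith
    · have hj' : j = l + 1 := by omega
      have hs0 := big hj'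
      subst hj'
      rcases h4 with h4 | h4
      · linarith [h4.2]
      · omega
  · intro hm3 hml D hD hD1 hD2
    have h16 := hpow4 hm3
    have hDl : y ^ D ≤ y ^ 2 ^ l := mono (by omega)
    have hD0 := pos D
    rcases lt_trichotomy j l with hlt | heq | hgt
    · have := small hlt hm3
      nlinarith
    · rcases mid heq hm3 with ⟨d, hd, hdl, hXd⟩ | ⟨h, _⟩
      · refine hXd.trans (mul_le_mul_of_nonneg_right ?_ (one_sub_nonneg _))
        have : y ^ D ≤ y ^ d := mono (by
          obtain ⟨c, hc⟩ := hd
          obtain ⟨c', hc'⟩ := hD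
          omega)
        linarith
      · omega
    · obtain ⟨d, hd, hdl, hXd⟩ := big' (by omega) hm3
      have k := hdouble d hd (by omega) (by omega)
      have k2 : y ^ d ≤ 1 := pow_le_one₀ hy0.le hy1.le
      have k3 := pos (2 ^ (l + 1))
      have : (1 - y ^ d) * (1 - y ^ 2 ^ (l + 1)) ≤ 1 - y ^ d := by nlinarith
      nlinarith
  · intro hm3 hml
    have h16 := hpow4 hm3
    rw [hh2]
    have hcube : (0:ℝ) ≤ (y ^ 2 ^ l) ^ 2 * (1 - y ^ 2 ^ l) := mul_nonneg (by positivity) (by linarith)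
    rcases lt_trichotomy j l with hlt | heq | hgt
    · have := small hlt hm3
      nlinarith
    · rcases mid heq hm3 with ⟨d, hd, hdl, hXd⟩ | ⟨_, _, h⟩
      · have := pos d
        have k : (1 - y ^ d) * (1 - y ^ 2 ^ l) ≤ 1 - y ^ 2 ^ l := by nlinarith
        nlinarith
      · linarith [h hml]
    · obtain ⟨d, hd, hdl, hXd⟩ := big' (by omega) hm3
      have k := hdouble d hd (by omega) (by omega)
      have k2 : y ^ d ≤ 1 := pow_le_one₀ hy0.le hy1.le
      have k3 := pos (2 ^ (l + 1))
      have : (1 - y ^ d) * (1 - y ^ 2 ^ (l + 1)) ≤ 1 - y ^ d := by nlinarith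
      nlinarith
  · intro hm3 hml D hD hD1 hD2
    have h16 := hpow4 hm3
    have hDl : y ^ D ≤ y ^ (2 ^ l + 1) := by
      apply mono
      obtain ⟨c, hc⟩ := hD
      have hev : 2 ^ l % 2 = 0 := by
        rcases hodd with ho | ho
        · obtain ⟨c', hc'⟩ := ho
          omega
        · omega
      omega
    have e : y ^ (2 ^ l + 1) = y ^ 2 ^ l / 2 := by rw [pow_succ, hy]; ring
    rw [e] at hDl
    have hD0 := pos D
    have hT : 1 - y ^ 2 ^ l / 2 - (y ^ 2 ^ l) ^ 2 ≤ (1 - y ^ D) * (1 - y ^ 2 ^ (l + 1)) := by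
      rw [hh2]
      have : 0 ≤ y ^ D * (y ^ 2 ^ l) ^ 2 := by positivity
      nlinarith
    rcases lt_trichotomy j l with hlt | heq | hgt
    · have := small hlt hm3
      nlinarith
    · rcases mid heq hm3 with ⟨d, hd, hdl, hXd⟩ | ⟨_, h, _⟩
      · have := pos d
        have k : (1 - y ^ d) * (1 - y ^ 2 ^ l) ≤ 1 - y ^ 2 ^ l := by nlinarith
        nlinarith
      · nlinarith
    · obtain ⟨d, hd, hdl, hXd⟩ := big' (by omega) hm3
      refine hXd.trans (mul_le_mul_of_nonneg_right ?_ (one_sub_nonneg _))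
      have : y ^ D ≤ y ^ d := mono (by
        obtain ⟨c, hc⟩ := hd
        obtain ⟨c', hc'⟩ := hD
        omega)
      linarith

end Core
section Upper

lemma cast_minus (q : ℕ) (hq : 1 ≤ q) (u : ℕ) :
    ((q ^ u - 1 : ℕ) : ℝ) = (q : ℝ) ^ u * (1 - (q : ℝ)⁻¹ ^ u) := by
  have hq0 : (0 : ℝ) < q := by exact_mod_cast hq
  have e : (q : ℝ) ^ u * (q : ℝ)⁻¹ ^ u = 1 := by
    rw [← mul_pow, mul_inv_cancel₀ hq0.ne', one_pow]
  rw [Nat.cast_sub (Nat.one_le_pow _ _ hq)]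
  push_cast
  rw [mul_sub, e, mul_one]

lemma cast_plus (q : ℕ) (hq : 1 ≤ q) (u : ℕ) :
    ((q ^ u + 1 : ℕ) : ℝ) = (q : ℝ) ^ u * (1 + (q : ℝ)⁻¹ ^ u) := by
  have hq0 : (0 : ℝ) < q := by exact_mod_cast hq
  have e : (q : ℝ) ^ u * (q : ℝ)⁻¹ ^ u = 1 := by
    rw [← mul_pow, mul_inv_cancel₀ hq0.ne', one_pow]
  push_cast
  rw [mul_add, e, mul_one]

/-- `v` bounds every `L_{m,q}(m', ℘)` from above. -/
def Up (q m v : ℕ) : Prop :=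
  ∀ mp ≤ m, ∀ P : List (ℕ × Bool), IsSignedPartition (m - mp) P → Lfun q mp P ≤ v

lemma up_four (q : ℕ) (hq : Even q) (hq4 : 4 ≤ q) (m v : ℕ) (T : ℝ) (hv : (v : ℝ) = (q : ℝ) ^ m * T)
    (hT : 1 ≤ T)
    (hgood : ∀ (p : ℕ) (E : Finset ℕ) (a : ℝ), Good 0 E → p + ∑ e ∈ E, e = m → 0 ≤ a → a ≤ 1 →
      (p = 0 ∨ (Odd p ∧ a ≤ 1 - (q : ℝ)⁻¹ ^ p)) → a * ∏ e ∈ E, (1 + (q : ℝ)⁻¹ ^ e) ≤ T) :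
    Up q m v := by
  intro mp hmp P hP
  have hq0 : (0 : ℝ) < q := by
    have : 0 < q := by omega
    exact_mod_cast this
  have hq4' : (4 : ℝ) ≤ q := by exact_mod_cast hq4
  obtain ⟨p, r, a, b, hpr, hle, ha0, ha1, hb0, hb1, hA, hB⟩ := reduce q hq (by omega) (m - mp) P hP
  obtain ⟨hc1, hc2⟩ := clog_factor_four q hq4 mp
  have hy1 : (q : ℝ)⁻¹ ≤ 1 / 4 := by
    rw [inv_le_comm₀ hq0 (by norm_num)]
    linarith
  have hy0 : (0 : ℝ) < (q : ℝ)⁻¹ := by positivity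
  have hb43 : b ≤ 4 / 3 := by nlinarith
  have hab0 : 0 ≤ a * b := mul_nonneg ha0 hb0
  have habb : a * b ≤ b := by nlinarith
  -- main estimate
  have main : (2 : ℝ) ^ Nat.clog 2 (2 * mp) * (q : ℝ)⁻¹ ^ mp * (a * b) ≤ T := by
    have hcpos : (0 : ℝ) ≤ (2 : ℝ) ^ Nat.clog 2 (2 * mp) * (q : ℝ)⁻¹ ^ mp := by positivity
    generalize (2 : ℝ) ^ Nat.clog 2 (2 * mp) * (q : ℝ)⁻¹ ^ mp = c at *
    have hcab : c * (a * b) ≤ a * b := by nlinarith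
    by_cases hmp0 : mp = 0
    · rcases hB with ⟨E, hE, hEs, hEb⟩ | hB
      · rcases hA with hA | ⟨d, hd, hdp, had, hdq⟩ | ⟨-, hA⟩
        · refine (hcab.trans (mul_le_mul_of_nonneg_left hEb ha0)).trans ?_
          exact hgood p E a hE (by omega) ha0 ha1 (Or.inl hA)
        · refine (hcab.trans (mul_le_mul_of_nonneg_left hEb ha0)).trans ?_
          have : d = p := hdq (by omega)
          subst this
          exact hgood d E a hE (by omega) ha0 ha1 (Or.inr ⟨hd, had⟩)
        · have : a ≤ 1 / 3 := by nlinarith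
          nlinarith
      · have : b ≤ 1 / 3 := by nlinarith
        linarith
    · have := hc2 hmp0
      nlinarith
  have hfin : (Lfun q mp P : ℝ) ≤ v := by
    have e1 : (q : ℝ) ^ m = (q : ℝ) ^ mp * (q : ℝ) ^ (m - mp) := by
      rw [← pow_add]; congr 1; clear hA hB; omega
    have e2 : ∀ u : ℕ, (q : ℝ) ^ u * (q : ℝ)⁻¹ ^ u = 1 := fun u => by
      rw [← mul_pow, mul_inv_cancel₀ hq0.ne', one_pow]
    rw [hv]
    unfold Lfun
    set l : ℕ := (P.map (partVal q)).foldr Nat.lcm 1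
    push_cast
    set C : ℝ := (2 : ℝ) ^ Nat.clog 2 (2 * mp)
    have hC : 0 ≤ C := by positivity
    calc C * (l : ℝ) = (q : ℝ) ^ m * (C * (q : ℝ)⁻¹ ^ mp * (l * (q : ℝ)⁻¹ ^ (m - mp))) := by
          rw [e1]
          linear_combination (-(C * l) * ((q:ℝ) ^ (m - mp) * (q:ℝ)⁻¹ ^ (m - mp))) * e2 mp -
            (C * l) * e2 (m - mp)
      _ ≤ (q : ℝ) ^ m * (C * (q : ℝ)⁻¹ ^ mp * (a * b)) := by
          gcongr
      _ ≤ _ := by gcongr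
  exact_mod_cast hfin

lemma up_two (m v : ℕ) (T : ℝ) (hv : (v : ℝ) = (2 : ℝ) ^ m * (2 * T))
    (hT : 1 / 2 ≤ T)
    (hgood : ∀ (mp p : ℕ) (E : Finset ℕ) (a X : ℝ), mp ≤ 3 → Good 0 E → mp + p + ∑ e ∈ E, e = m →
      0 ≤ a → a ≤ 1 → (p = 0 ∨ ∃ d, Odd d ∧ d ≤ p ∧ a ≤ 1 - (2 : ℝ)⁻¹ ^ d) →
      X = a * ((∏ e ∈ E, (1 + (2 : ℝ)⁻¹ ^ e)) * (1 - (2 : ℝ)⁻¹)) → X ≤ T) :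
    Up 2 m v := by
  intro mp hmp P hP
  obtain ⟨p, r, a, b, hpr, hle, ha0, ha1, hb0, hb1, hA, hB⟩ :=
    reduce 2 (by decide) le_rfl (m - mp) P hP
  obtain ⟨hc1, hc2⟩ := clog_factor_two mp
  simp only [Nat.cast_ofNat] at *
  have hb2 : b ≤ 2 := by
    norm_num at hb1; linarith
  have hab0 : 0 ≤ a * b := mul_nonneg ha0 hb0
  have habb : a * b ≤ b := by nlinarith
  have main : (2 : ℝ) ^ Nat.clog 2 (2 * mp) * (2 : ℝ)⁻¹ ^ mp * (a * b) ≤ 2 * T := by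
    have hcpos : (0 : ℝ) ≤ (2 : ℝ) ^ Nat.clog 2 (2 * mp) * (2 : ℝ)⁻¹ ^ mp := by positivity
    generalize (2 : ℝ) ^ Nat.clog 2 (2 * mp) * (2 : ℝ)⁻¹ ^ mp = c at *
    have hcab : c * (a * b) ≤ a * b := by nlinarith
    by_cases hmp0 : mp ≤ 3
    · rcases hB with ⟨E, hE, hEs, hEb⟩ | hB
      · have h1 : a * b ≤ a * ∏ e ∈ E, (1 + (2 : ℝ)⁻¹ ^ e) := mul_le_mul_of_nonneg_left hEb ha0
        have h2 := hgood mp p E a _ hmp0 hE (by clear hA; omega) ha0 ha1 (by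
          rcases hA with hA | ⟨d, hd, hdp, had, hdq⟩ | ⟨h, -⟩
          · exact Or.inl hA
          · exact Or.inr ⟨d, hd, hdp, had⟩
          · exact absurd rfl h) rfl
        have e : a * ((∏ e ∈ E, (1 + (2 : ℝ)⁻¹ ^ e)) * (1 - (2 : ℝ)⁻¹)) =
          (a * ∏ e ∈ E, (1 + (2 : ℝ)⁻¹ ^ e)) / 2 := by ring
        rw [e] at h2
        linarith
      · linarith
    · have := hc2 (by omega)
      nlinarith
  have hfin : (Lfun 2 mp P : ℝ) ≤ v := by
    have e1 : (2 : ℝ) ^ m = (2 : ℝ) ^ mp * (2 : ℝ) ^ (m - mp) := by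
      rw [← pow_add]; congr 1; clear hA hB; omega
    have e2 : ∀ u : ℕ, (2 : ℝ) ^ u * (2 : ℝ)⁻¹ ^ u = 1 := fun u => by
      rw [← mul_pow]; norm_num
    rw [hv]
    unfold Lfun
    set l : ℕ := (P.map (partVal 2)).foldr Nat.lcm 1
    push_cast
    set C : ℝ := (2 : ℝ) ^ Nat.clog 2 (2 * mp)
    have hC : 0 ≤ C := by positivity
    calc C * (l : ℝ) = (2 : ℝ) ^ m * (C * (2 : ℝ)⁻¹ ^ mp * (l * (2 : ℝ)⁻¹ ^ (m - mp))) := by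
          rw [e1]
          linear_combination (-(C * l) * ((2:ℝ) ^ (m - mp) * (2:ℝ)⁻¹ ^ (m - mp))) * e2 mp -
            (C * l) * e2 (m - mp)
      _ ≤ (2 : ℝ) ^ m * (C * (2 : ℝ)⁻¹ ^ mp * (a * b)) := by
          gcongr
      _ ≤ _ := by gcongr
  exact_mod_cast hfin

end Upper

section Attain

/-- `v` is one of the values `L_{m,q}(m', ℘)`. -/
def Att (q m v : ℕ) : Prop :=
  ∃ mp ≤ m, ∃ P : List (ℕ × Bool), IsSignedPartition (m - mp) P ∧ Lfun q mp P = v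

lemma prod_minus (q L : ℕ) (hq : 1 ≤ q) :
    (∏ i ∈ Finset.range L, (q ^ 2 ^ i + 1)) * (q - 1) = q ^ 2 ^ L - 1 := by
  induction L with
  | zero => simp
  | succ L ih =>
    rw [Finset.prod_range_succ, mul_right_comm, ih, pow_succ, pow_mul, mul_comm]
    have := Nat.sq_sub_sq (q ^ 2 ^ L) 1
    rw [one_pow] at this
    exact this.symm

lemma sum_pow_two (L : ℕ) : ∑ i ∈ Finset.range L, 2 ^ i = 2 ^ L - 1 := by
  have := Nat.geomSum_eq (le_refl 2) L
  simpa using this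

lemma coprime_of_dvd_two {a b : ℕ} (ha : Odd a) (h : Nat.gcd a b ∣ 2) : Nat.Coprime a b := by
  rcases (Nat.dvd_prime Nat.prime_two).1 h with h | h
  · exact h
  · exfalso
    have : 2 ∣ a := h ▸ Nat.gcd_dvd_left a b
    exact (Nat.not_even_iff_odd.2 ha) (even_iff_two_dvd.2 this)

lemma odd_plus (q : ℕ) (hq : Even q) (u : ℕ) (hu : u ≠ 0) : Odd (q ^ u + 1) :=
  (hq.pow_of_ne_zero hu).add_one

lemma plus_dvd_minus (q i j : ℕ) (hij : i < j) : q ^ 2 ^ i + 1 ∣ q ^ 2 ^ j - 1 := by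
  have h1 : q ^ 2 ^ i + 1 ∣ q ^ 2 ^ (i + 1) - 1 := by
    rw [pow_succ, pow_mul]
    have := Nat.sq_sub_sq (q ^ 2 ^ i) 1
    rw [one_pow] at this
    rw [this]
    exact Dvd.intro _ rfl
  exact h1.trans (Nat.pow_sub_one_dvd_pow_sub_one _ (pow_dvd_pow 2 hij))

lemma coprime_plus (q i j : ℕ) (hq : Even q) (hq2 : 2 ≤ q) (hij : i < j) :
    Nat.Coprime (q ^ 2 ^ i + 1) (q ^ 2 ^ j + 1) := by
  apply coprime_of_dvd_two (odd_plus q hq _ (by positivity))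
  have h1 := (Nat.gcd_dvd_left (q ^ 2 ^ i + 1) (q ^ 2 ^ j + 1)).trans (plus_dvd_minus q i j hij)
  have h2 := Nat.gcd_dvd_right (q ^ 2 ^ i + 1) (q ^ 2 ^ j + 1)
  have h3 := Nat.dvd_sub h2 h1
  have : 1 ≤ q ^ 2 ^ j := Nat.one_le_pow _ _ (by omega)
  rwa [show q ^ 2 ^ j + 1 - (q ^ 2 ^ j - 1) = 2 by omega] at h3

lemma coprime_minus_plus (q d i : ℕ) (hq : Even q) (hq2 : 2 ≤ q) (hd : Odd d) :
    Nat.Coprime (q ^ 2 ^ i + 1) (q ^ d - 1) := by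
  apply coprime_of_dvd_two (odd_plus q hq _ (by positivity))
  set g := Nat.gcd (q ^ 2 ^ i + 1) (q ^ d - 1) with hg
  have h0 : g ∣ q ^ 2 ^ i + 1 := Nat.gcd_dvd_left _ _
  have h1 : g ∣ q ^ 2 ^ (i + 1) - 1 := h0.trans (plus_dvd_minus q i (i + 1) (by omega))
  have h2 : g ∣ q ^ d - 1 := Nat.gcd_dvd_right _ _
  have h3 := Nat.dvd_gcd h1 h2
  have hc : Nat.gcd (2 ^ (i + 1)) d = 1 := Nat.Coprime.pow_left _ (Nat.coprime_two_left.2 hd)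
  rw [Nat.pow_sub_one_gcd_pow_sub_one, hc, pow_one] at h3
  have h4 : g ∣ q ^ 2 ^ i - 1 := by
    refine h3.trans ?_
    have := Nat.pow_sub_one_dvd_pow_sub_one q (one_dvd (2 ^ i))
    rwa [pow_one] at this
  have h5 := Nat.dvd_sub h0 h4
  have : 1 ≤ q ^ 2 ^ i := Nat.one_le_pow _ _ (by omega)
  rwa [show q ^ 2 ^ i + 1 - (q ^ 2 ^ i - 1) = 2 by omega] at h5

lemma pairwise_plus (q : ℕ) (hq : Even q) (hq2 : 2 ≤ q) (S : Finset ℕ) :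
    (S.toList.map fun i => q ^ 2 ^ i + 1).Pairwise Nat.Coprime := by
  rw [List.pairwise_map]
  refine S.nodup_toList.imp ?_
  intro i j hij
  rcases lt_or_gt_of_ne hij with h | h
  · exact coprime_plus q i j hq hq2 h
  · exact (coprime_plus q j i hq hq2 h).symm

lemma att_plus (q : ℕ) (hq : Even q) (hq2 : 2 ≤ q) (m mp : ℕ) (S : Finset ℕ)
    (hm : mp + ∑ i ∈ S, 2 ^ i = m) :
    Att q m (2 ^ Nat.clog 2 (2 * mp) * ∏ i ∈ S, (q ^ 2 ^ i + 1)) := by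
  refine ⟨mp, by omega, S.toList.map (fun i => (2 ^ i, false)), ⟨?_, ?_⟩, ?_⟩
  · intro x hx
    obtain ⟨i, -, rfl⟩ := List.mem_map.1 hx
    positivity
  · rw [List.map_map]
    have := Finset.sum_map_toList S (fun i => 2 ^ i)
    simp only [Function.comp_def]
    omega
  · unfold Lfun
    congr 1
    rw [List.map_map]
    have h1 : (partVal q ∘ fun i : ℕ => (2 ^ i, false)) = fun i => q ^ 2 ^ i + 1 := by
      funext i; simp [partVal]
    rw [h1]
    have := lcmL_eq_prod (pairwise_plus q hq hq2 S)
    rw [Finset.prod_map_toList] at this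
    exact this

lemma att_minus (q : ℕ) (hq : Even q) (hq2 : 2 ≤ q) (m mp d : ℕ) (hd : Odd d) (S : Finset ℕ)
    (hm : mp + d + ∑ i ∈ S, 2 ^ i = m) :
    Att q m (2 ^ Nat.clog 2 (2 * mp) * ((q ^ d - 1) * ∏ i ∈ S, (q ^ 2 ^ i + 1))) := by
  refine ⟨mp, by omega, (d, true) :: S.toList.map (fun i => (2 ^ i, false)), ⟨?_, ?_⟩, ?_⟩
  · intro x hx
    rcases List.mem_cons.1 hx with rfl | hx
    · exact hd.pos
    · obtain ⟨i, -, rfl⟩ := List.mem_map.1 hx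
      positivity
  · rw [List.map_cons, List.sum_cons, List.map_map]
    have := Finset.sum_map_toList S (fun i => 2 ^ i)
    simp only [Function.comp_def]
    omega
  · unfold Lfun
    congr 1
    rw [List.map_cons, List.map_map]
    have h1 : (partVal q ∘ fun i : ℕ => (2 ^ i, false)) = fun i => q ^ 2 ^ i + 1 := by
      funext i; simp [partVal]
    have h2 : partVal q (d, true) = q ^ d - 1 := by simp [partVal]
    rw [h1, h2]
    have hpw : (((q ^ d - 1) :: S.toList.map fun i => q ^ 2 ^ i + 1)).Pairwise Nat.Coprime := by
      rw [List.pairwise_cons]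
      refine ⟨?_, pairwise_plus q hq hq2 S⟩
      intro x hx
      obtain ⟨i, -, rfl⟩ := List.mem_map.1 hx
      exact (coprime_minus_plus q d i hq hq2 hd).symm
    have := lcmL_eq_prod hpw
    rw [List.prod_cons, Finset.prod_map_toList] at this
    exact this

end Attain
section Final

lemma spec_two (m : ℕ) (hm : 1 ≤ m) :
    ∃ L m0 : ℕ, Nat.findGreatest (fun l => 0 < l ∧ 2 ^ l - 1 ≤ m) m = L ∧ m - (2 ^ L - 1) = m0 ∧
      1 ≤ L ∧ m = 2 ^ L - 1 + m0 ∧ m0 < 2 ^ L := by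
  set L := Nat.findGreatest (fun l => 0 < l ∧ 2 ^ l - 1 ≤ m) m with hL
  have hspec : 0 < L ∧ 2 ^ L - 1 ≤ m :=
    Nat.findGreatest_spec (P := fun l => 0 < l ∧ 2 ^ l - 1 ≤ m) hm ⟨one_pos, by simpa using hm⟩
  have hgt : m < 2 ^ (L + 1) - 1 := by
    by_contra h
    have hlt : L + 1 < 2 ^ (L + 1) := Nat.lt_two_pow_self
    exact Nat.findGreatest_is_greatest (P := fun l => 0 < l ∧ 2 ^ l - 1 ≤ m) (n := m) (k := L + 1)
      (by rw [← hL]; omega) (by omega) ⟨by omega, by omega⟩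
  refine ⟨L, _, rfl, rfl, hspec.1, by omega, ?_⟩
  rw [pow_succ] at hgt
  have : 0 < 2 ^ L := by positivity
  omega

lemma spec_four (m : ℕ) (hm : 3 ≤ m) :
    ∃ L : ℕ, Nat.findGreatest (fun l => 0 < l ∧ 2 ^ l + 2 ^ (l - 1) ≤ m) m = L ∧
      1 ≤ L ∧ 2 ^ L + 2 ^ (L - 1) ≤ m ∧ m < 3 * 2 ^ L := by
  set L := Nat.findGreatest (fun l => 0 < l ∧ 2 ^ l + 2 ^ (l - 1) ≤ m) m with hL
  have hspec : 0 < L ∧ 2 ^ L + 2 ^ (L - 1) ≤ m :=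
    Nat.findGreatest_spec (P := fun l => 0 < l ∧ 2 ^ l + 2 ^ (l - 1) ≤ m) (m := 1) (by omega)
      ⟨one_pos, by simpa using hm⟩
  refine ⟨L, rfl, hspec.1, hspec.2, ?_⟩
  by_contra h
  have hlt : L + 1 < 2 ^ (L + 1) := Nat.lt_two_pow_self
  have hp : 2 ^ (L + 1) = 2 * 2 ^ L := by rw [pow_succ]; ring
  exact Nat.findGreatest_is_greatest (P := fun l => 0 < l ∧ 2 ^ l + 2 ^ (l - 1) ≤ m) (n := m)
    (k := L + 1) (by rw [← hL]; omega) (by omega) ⟨by omega, by rw [Nat.add_sub_cancel]; omega⟩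

lemma sum_bits (m : ℕ) :
    ∑ i ∈ (Finset.range (m + 1)).filter (fun i => m.testBit i = true), 2 ^ i = m := by
  have h : ∀ n m : ℕ, m < 2 ^ n →
      ∑ i ∈ (Finset.range n).filter (fun i => m.testBit i = true), 2 ^ i = m := by
    intro n
    induction n with
    | zero => intro m hm; simp at hm; simp [hm]
    | succ n ih =>
      intro m hm
      have h2 := ih (m / 2) (by rw [pow_succ] at hm; omega)
      rw [Finset.sum_filter] at h2 ⊢
      rw [Finset.sum_range_succ']
      have : ∀ i ∈ Finset.range n, (if m.testBit (i + 1) = true then 2 ^ (i + 1) else 0) =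
          2 * (if (m / 2).testBit i = true then 2 ^ i else 0) := by
        intro i _
        rw [Nat.testBit_succ]
        split_ifs
        · rw [pow_succ]; ring
        · rfl
      rw [Finset.sum_congr rfl this, ← Finset.mul_sum, h2, Nat.testBit_zero]
      rcases Nat.mod_two_eq_zero_or_one m with h | h <;> simp [h] <;> omega
  exact h (m + 1) m (Nat.lt_two_pow_self.trans (Nat.pow_lt_pow_right (by norm_num) (by omega)))

lemma clog_small (k : ℕ) (hk : k ≤ 3) : 2 ^ Nat.clog 2 (2 * k) = 2 ^ k := by
  interval_cases k <;> decide

lemma final_odd (q m : ℕ) (hq : Even q) (hq4 : 4 ≤ q) (hm : Odd m) :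
    Att q m (∏ i ∈ Finset.range (m + 1), if m.testBit i then q ^ 2 ^ i + 1 else 1) ∧
    Up q m (∏ i ∈ Finset.range (m + 1), if m.testBit i then q ^ 2 ^ i + 1 else 1) := by
  have hq0 : (0 : ℝ) < q := by
    have : 0 < q := by omega
    exact_mod_cast this
  have hq4' : (4 : ℝ) ≤ q := by exact_mod_cast hq4
  have hy1 : (q : ℝ)⁻¹ ≤ 1 / 4 := by
    rw [inv_le_comm₀ hq0 (by norm_num)]
    linarith
  have hy0 : (0 : ℝ) < (q : ℝ)⁻¹ := by positivity
  constructor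
  · have := att_plus q hq (by omega) m 0
      ((Finset.range (m + 1)).filter (fun i => m.testBit i = true)) (by rw [sum_bits]; omega)
    rw [Finset.prod_filter] at this
    simpa using this
  · apply up_four q hq hq4 m _
      (∏ i ∈ Finset.range (m + 1), if m.testBit i then 1 + (q : ℝ)⁻¹ ^ 2 ^ i else 1)
    · have h1 : (q : ℝ) ^ m =
          ∏ i ∈ Finset.range (m + 1), if m.testBit i then (q : ℝ) ^ 2 ^ i else 1 := by
        conv_lhs => rw [← sum_bits m]
        rw [← Finset.prod_pow_eq_pow_sum, Finset.prod_filter]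
      rw [h1, ← Finset.prod_mul_distrib, Nat.cast_prod]
      apply Finset.prod_congr rfl
      intro i _
      split_ifs
      · exact cast_plus q (by omega) _
      · simp
    · apply Finset.prod_induction _ (fun x : ℝ => 1 ≤ x)
      · intro a b ha hb; nlinarith
      · exact le_rfl
      · intro i _
        split_ifs
        · have : 0 < (q : ℝ)⁻¹ ^ 2 ^ i := by positivity
          linarith
        · exact le_rfl
    · intro p E a hE hs ha0 ha1 hp
      exact core_odd _ hy0 hy1 m p hm E hE hs a ha0 ha1 hp

lemma final_m2 (q : ℕ) (hq : Even q) (hq4 : 4 ≤ q) : Att q 2 (q ^ 2 + 1) ∧ Up q 2 (q ^ 2 + 1) := by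
  have hq0 : (0 : ℝ) < q := by
    have : 0 < q := by omega
    exact_mod_cast this
  have hq4' : (4 : ℝ) ≤ q := by exact_mod_cast hq4
  have hy1 : (q : ℝ)⁻¹ ≤ 1 / 4 := by
    rw [inv_le_comm₀ hq0 (by norm_num)]
    linarith
  have hy0 : (0 : ℝ) < (q : ℝ)⁻¹ := by positivity
  constructor
  · have := att_plus q hq (by omega) 2 0 {1} (by simp)
    simpa using this
  · apply up_four q hq hq4 2 _ (1 + (q : ℝ)⁻¹ ^ 2)
    · exact cast_plus q (by omega) 2
    · have : 0 < (q : ℝ)⁻¹ ^ 2 := by positivity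
      linarith
    · intro p E a hE hs ha0 ha1 hp
      have h := core_two _ hy0 hy1 p E hE hs a ha0 ha1 hp
      rw [← mul_assoc, mul_comm (1 - _)] at h
      exact le_of_mul_le_mul_right h (by linarith)

lemma final_even (q m L : ℕ) (hq : Even q) (hq4 : 4 ≤ q) (hm : Even m) (hL : 1 ≤ L)
    (hL1 : 2 ^ L + 2 ^ (L - 1) ≤ m) (hL2 : m < 3 * 2 ^ L) :
    Att q m ((q ^ (m - 2 ^ L + 1) - 1) * (q ^ 2 ^ L - 1) / (q - 1)) ∧
    Up q m ((q ^ (m - 2 ^ L + 1) - 1) * (q ^ 2 ^ L - 1) / (q - 1)) := by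
  have hq0 : (0 : ℝ) < q := by
    have : 0 < q := by omega
    exact_mod_cast this
  have hq4' : (4 : ℝ) ≤ q := by exact_mod_cast hq4
  have hy1 : (q : ℝ)⁻¹ ≤ 1 / 4 := by
    rw [inv_le_comm₀ hq0 (by norm_num)]
    linarith
  have hy0 : (0 : ℝ) < (q : ℝ)⁻¹ := by positivity
  have hval : (q ^ (m - 2 ^ L + 1) - 1) * (q ^ 2 ^ L - 1) / (q - 1) =
      (q ^ (m - 2 ^ L + 1) - 1) * ∏ i ∈ Finset.range L, (q ^ 2 ^ i + 1) := by
    rw [← prod_minus q L (by omega), ← mul_assoc, Nat.mul_div_cancel _ (by omega)]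
  have hpL : 2 ^ L % 2 = 0 :=
    Nat.even_iff.1 ((by decide : Even 2).pow_of_ne_zero (by omega))
  have hodd : Odd (m - 2 ^ L + 1) := by
    rw [Nat.odd_iff]
    have := Nat.even_iff.1 hm
    omega
  have h1 : 1 ≤ 2 ^ (L - 1) := Nat.one_le_two_pow
  have h2 : 2 ≤ 2 ^ L := by
    have : 0 < 2 ^ L := by positivity
    omega
  rw [hval]
  constructor
  · have := att_minus q hq (by omega) m 0 (m - 2 ^ L + 1) hodd (Finset.range L)
      (by rw [sum_pow_two]; omega)
    simpa using this
  · apply up_four q hq hq4 m _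
      ((1 - (q : ℝ)⁻¹ ^ (m - 2 ^ L + 1)) * (1 - (q : ℝ)⁻¹ ^ 2 ^ L) / (1 - (q : ℝ)⁻¹))
    · have e := prod_minus q L (by omega)
      have e' : ((∏ i ∈ Finset.range L, (q ^ 2 ^ i + 1) : ℕ) : ℝ) * ((q : ℝ) ^ 1 * (1 - (q : ℝ)⁻¹ ^ 1)) =
          (q : ℝ) ^ 2 ^ L * (1 - (q : ℝ)⁻¹ ^ 2 ^ L) := by
        rw [← cast_minus q (by omega), ← cast_minus q (by omega), ← Nat.cast_mul, pow_one, e]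
      rw [Nat.cast_mul, cast_minus q (by omega)]
      have hne : (1 - (q : ℝ)⁻¹) ≠ 0 := by
        have : (0:ℝ) < 1 - (q : ℝ)⁻¹ := by linarith
        exact this.ne'
      rw [mul_div_assoc', eq_div_iff hne]
      have e3 : (q : ℝ) ^ (m - 2 ^ L + 1) * (q : ℝ) ^ 2 ^ L = q ^ m * q := by
        rw [← pow_add, ← pow_succ]; congr 1; omega
      rw [pow_one, pow_one] at e'
      apply mul_right_cancel₀ hq0.ne'
      linear_combination ((q : ℝ) ^ (m - 2 ^ L + 1) * (1 - (q : ℝ)⁻¹ ^ (m - 2 ^ L + 1))) * e' +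
        ((1 - (q : ℝ)⁻¹ ^ (m - 2 ^ L + 1)) * (1 - (q : ℝ)⁻¹ ^ 2 ^ L)) * e3
    · rw [le_div_iff₀ (by linarith)]
      generalize (q : ℝ)⁻¹ = y at *
      have k1 : y ^ (m - 2 ^ L + 1) ≤ y ^ 2 := pow_le_pow_of_le_one hy0.le (by linarith) (by omega)
      have k2 : y ^ 2 ^ L ≤ y ^ 2 := pow_le_pow_of_le_one hy0.le (by linarith) (by omega)
      have k3 : 0 ≤ y ^ (m - 2 ^ L + 1) * y ^ 2 ^ L := by positivity
      nlinarith
    · intro p E a hE hs ha0 ha1 hp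
      have h := core_even _ hy0 hy1 m L p hm hL hL1 hL2 E hE hs a ha0 ha1 hp
      rw [← mul_assoc] at h
      rw [le_div_iff₀ (by linarith)]
      exact h

lemma prod_minus_two (L : ℕ) : ∏ i ∈ Finset.range L, (2 ^ 2 ^ i + 1) = 2 ^ 2 ^ L - 1 := by
  have := prod_minus 2 L (by norm_num)
  simpa using this

/-- `q = 2` -/
lemma final_two (m L m0 : ℕ) (hL : 1 ≤ L) (hm : m = 2 ^ L - 1 + m0) (hm0 : m0 < 2 ^ L) (v : ℕ)
    (hv : v = if m0 ≤ 3 then 2 ^ m0 * (2 ^ 2 ^ L - 1)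
    else if m0 < 2 ^ (L - 1) then
      if Odd m0 then (2 ^ (2 ^ (L - 1) + m0) - 1) * (2 ^ 2 ^ (L - 1) - 1)
      else 2 * (2 ^ (2 ^ (L - 1) + m0 - 1) - 1) * (2 ^ 2 ^ (L - 1) - 1)
    else if m0 = 2 ^ (L - 1) then (2 ^ 2 ^ L + 1) * (2 ^ 2 ^ (L - 1) - 1)
    else if Odd m0 then (2 ^ m0 - 1) * (2 ^ 2 ^ L - 1)
    else 2 * (2 ^ (m0 - 1) - 1) * (2 ^ 2 ^ L - 1)) : Att 2 m v ∧ Up 2 m v := by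
  have hpL : 2 ^ L = 2 * 2 ^ (L - 1) := by
    rw [← pow_succ']; congr 1; omega
  have h1 : 1 ≤ 2 ^ (L - 1) := Nat.one_le_two_pow
  have cm : ∀ u : ℕ, ((2 ^ u - 1 : ℕ) : ℝ) = (2 : ℝ) ^ u * (1 - (2 : ℝ)⁻¹ ^ u) := fun u => by
    have := cast_minus 2 (by norm_num) u
    simpa only [Nat.cast_ofNat] using this
  have cp : ∀ u : ℕ, ((2 ^ u + 1 : ℕ) : ℝ) = (2 : ℝ) ^ u * (1 + (2 : ℝ)⁻¹ ^ u) := fun u => by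
    have := cast_plus 2 (by norm_num) u
    simpa only [Nat.cast_ofNat] using this
  have bd : ∀ u k : ℕ, k ≤ u → (2 : ℝ)⁻¹ ^ u ≤ (2 : ℝ)⁻¹ ^ k := fun u k h =>
    pow_le_pow_of_le_one (by norm_num) (by norm_num) h
  have pos : ∀ u : ℕ, (0 : ℝ) < (2 : ℝ)⁻¹ ^ u := fun u => by positivity
  have ev : 1 ≤ L - 1 → 2 ^ (L - 1) % 2 = 0 := fun h =>
    Nat.even_iff.1 ((by decide : Even 2).pow_of_ne_zero (by omega))
  have hL2 : 3 < m0 → 4 ≤ 2 ^ (L - 1) ∧ 1 ≤ L - 1 := by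
    intro h
    have : 2 ≤ L - 1 := by
      by_contra hc
      have : L ≤ 2 := by omega
      have : 2 ^ L ≤ 2 ^ 2 := Nat.pow_le_pow_right (by norm_num) this
      omega
    have h4 : 2 ^ 2 ≤ 2 ^ (L - 1) := Nat.pow_le_pow_right (by norm_num) this
    omega
  have core := fun (mp p : ℕ) (E : Finset ℕ) (a X : ℝ) (hmp : mp ≤ 3) (hE : Good 0 E)
      (hs : mp + p + ∑ e ∈ E, e = m) (ha0 : 0 ≤ a) (ha1 : a ≤ 1)
      (hp : p = 0 ∨ ∃ d, Odd d ∧ d ≤ p ∧ a ≤ 1 - (2 : ℝ)⁻¹ ^ d)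
      (hX : X = a * ((∏ e ∈ E, (1 + (2 : ℝ)⁻¹ ^ e)) * (1 - (2 : ℝ)⁻¹))) =>
    core2 (2 : ℝ)⁻¹ (by norm_num) L m m0 mp p hL hm hm0 hmp E hE hs a ha0 ha1 hp X hX
  -- the generic bound for products of two minus terms
  have two : ∀ A B : ℕ, 2 ≤ A → 2 ≤ B →
      (1 : ℝ) / 2 ≤ (1 - (2 : ℝ)⁻¹ ^ A) * (1 - (2 : ℝ)⁻¹ ^ B) := by
    intro A B hA hB
    have k1 := bd A 2 hA
    have k2 := bd B 2 hB
    norm_num at k1 k2 ⊢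
    nlinarith
  split_ifs at hv with c1 c2 c3 c4 c5
  · constructor
    · have := att_plus 2 (by decide) le_rfl m m0 (Finset.range L) (by rw [sum_pow_two]; omega)
      rw [prod_minus_two, clog_small m0 c1] at this
      rwa [hv]
    · apply up_two m v (1 - (2 : ℝ)⁻¹ ^ 2 ^ L)
      · rw [hv, Nat.cast_mul, cm]
        push_cast
        have e : (2 : ℝ) ^ m * 2 = 2 ^ m0 * 2 ^ 2 ^ L := by
          rw [← pow_succ, ← pow_add]; congr 1; omega
        linear_combination -(1 - (2 : ℝ)⁻¹ ^ 2 ^ L) * e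
      · have := bd (2 ^ L) 1 (by omega)
        norm_num at this ⊢
        linarith
      · intro mp p E a X hmp hE hs ha0 ha1 hp hX
        exact (core mp p E a X hmp hE hs ha0 ha1 hp hX).1 c1
  · have hh := hL2 (by omega)
    have hev := ev hh.2
    have hD : Odd (2 ^ (L - 1) + m0) := by
      rw [Nat.odd_iff] at c3 ⊢; omega
    constructor
    · have := att_minus 2 (by decide) le_rfl m 0 (2 ^ (L - 1) + m0) hD (Finset.range (L - 1))
        (by rw [sum_pow_two]; omega)
      rw [prod_minus_two] at this
      rw [hv]
      simpa using this
    · apply up_two m v ((1 - (2 : ℝ)⁻¹ ^ (2 ^ (L - 1) + m0)) * (1 - (2 : ℝ)⁻¹ ^ 2 ^ (L - 1)))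
      · rw [hv, Nat.cast_mul, cm, cm]
        have e : (2 : ℝ) ^ m * 2 = 2 ^ (2 ^ (L - 1) + m0) * 2 ^ 2 ^ (L - 1) := by
          rw [← pow_succ, ← pow_add]; congr 1; omega
        linear_combination
          -((1 - (2 : ℝ)⁻¹ ^ (2 ^ (L - 1) + m0)) * (1 - (2 : ℝ)⁻¹ ^ 2 ^ (L - 1))) * e
      · exact two _ _ (by omega) (by omega)
      · intro mp p E a X hmp hE hs ha0 ha1 hp hX
        exact (core mp p E a X hmp hE hs ha0 ha1 hp hX).2.1 (by omega) c2 _ hD (by omega) (by omega)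
  · have hh := hL2 (by omega)
    have hev := ev hh.2
    have hD : Odd (2 ^ (L - 1) + m0 - 1) := by
      rw [Nat.not_odd_iff] at c3
      rw [Nat.odd_iff]; omega
    constructor
    · have := att_minus 2 (by decide) le_rfl m 1 (2 ^ (L - 1) + m0 - 1) hD (Finset.range (L - 1))
        (by rw [sum_pow_two]; omega)
      rw [prod_minus_two, clog_small 1 (by omega), pow_one, ← mul_assoc] at this
      rwa [hv]
    · apply up_two m v ((1 - (2 : ℝ)⁻¹ ^ (2 ^ (L - 1) + m0 - 1)) * (1 - (2 : ℝ)⁻¹ ^ 2 ^ (L - 1)))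
      · rw [hv, Nat.cast_mul, Nat.cast_mul, cm, cm, Nat.cast_ofNat]
        have e : (2 : ℝ) ^ m * 2 = 2 * 2 ^ (2 ^ (L - 1) + m0 - 1) * 2 ^ 2 ^ (L - 1) := by
          rw [← pow_succ, ← pow_succ', ← pow_add]; congr 1; omega
        linear_combination
          -((1 - (2 : ℝ)⁻¹ ^ (2 ^ (L - 1) + m0 - 1)) * (1 - (2 : ℝ)⁻¹ ^ 2 ^ (L - 1))) * e
      · exact two _ _ (by omega) (by omega)
      · intro mp p E a X hmp hE hs ha0 ha1 hp hX
        exact (core mp p E a X hmp hE hs ha0 ha1 hp hX).2.1 (by omega) c2 _ hD (by omega) (by omega)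
  · have hh := hL2 (by omega)
    have hn : L ∉ Finset.range (L - 1) := by
      rw [Finset.mem_range]; omega
    constructor
    · have := att_plus 2 (by decide) le_rfl m 0 (insert L (Finset.range (L - 1)))
        (by rw [Finset.sum_insert hn, sum_pow_two]; omega)
      rw [Finset.prod_insert hn, prod_minus_two] at this
      rw [hv]
      simpa using this
    · apply up_two m v ((1 + (2 : ℝ)⁻¹ ^ 2 ^ L) * (1 - (2 : ℝ)⁻¹ ^ 2 ^ (L - 1)))
      · rw [hv, Nat.cast_mul, cm, cp]
        have e : (2 : ℝ) ^ m * 2 = 2 ^ 2 ^ L * 2 ^ 2 ^ (L - 1) := by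
          rw [← pow_succ, ← pow_add]; congr 1; omega
        linear_combination
          -((1 + (2 : ℝ)⁻¹ ^ 2 ^ L) * (1 - (2 : ℝ)⁻¹ ^ 2 ^ (L - 1))) * e
      · have k1 := pos (2 ^ L)
        have k2 := bd (2 ^ (L - 1)) 1 (by omega)
        rw [pow_one] at k2
        generalize (2 : ℝ)⁻¹ ^ 2 ^ L = u at *
        generalize (2 : ℝ)⁻¹ ^ 2 ^ (L - 1) = w at *
        norm_num at k2
        nlinarith
      · intro mp p E a X hmp hE hs ha0 ha1 hp hX
        exact (core mp p E a X hmp hE hs ha0 ha1 hp hX).2.2.1 (by omega) c4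
  · have hh := hL2 (by omega)
    constructor
    · have := att_minus 2 (by decide) le_rfl m 0 m0 c5 (Finset.range L)
        (by rw [sum_pow_two]; omega)
      rw [prod_minus_two] at this
      rw [hv]
      simpa using this
    · apply up_two m v ((1 - (2 : ℝ)⁻¹ ^ m0) * (1 - (2 : ℝ)⁻¹ ^ 2 ^ L))
      · rw [hv, Nat.cast_mul, cm, cm]
        have e : (2 : ℝ) ^ m * 2 = 2 ^ m0 * 2 ^ 2 ^ L := by
          rw [← pow_succ, ← pow_add]; congr 1; omega
        linear_combination -((1 - (2 : ℝ)⁻¹ ^ m0) * (1 - (2 : ℝ)⁻¹ ^ 2 ^ L)) * e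
      · exact two _ _ (by omega) (by omega)
      · intro mp p E a X hmp hE hs ha0 ha1 hp hX
        exact (core mp p E a X hmp hE hs ha0 ha1 hp hX).2.2.2 (by omega) (by omega) _ c5
          (by omega) (by omega)
  · have hh := hL2 (by omega)
    have hD : Odd (m0 - 1) := by
      rw [Nat.not_odd_iff] at c5
      rw [Nat.odd_iff]; omega
    constructor
    · have := att_minus 2 (by decide) le_rfl m 1 (m0 - 1) hD (Finset.range L)
        (by rw [sum_pow_two]; omega)
      rw [prod_minus_two, clog_small 1 (by omega), pow_one, ← mul_assoc] at this
      rwa [hv]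
    · apply up_two m v ((1 - (2 : ℝ)⁻¹ ^ (m0 - 1)) * (1 - (2 : ℝ)⁻¹ ^ 2 ^ L))
      · rw [hv, Nat.cast_mul, Nat.cast_mul, cm, cm, Nat.cast_ofNat]
        have e : (2 : ℝ) ^ m * 2 = 2 * 2 ^ (m0 - 1) * 2 ^ 2 ^ L := by
          rw [← pow_succ, ← pow_succ', ← pow_add]; congr 1; omega
        linear_combination -((1 - (2 : ℝ)⁻¹ ^ (m0 - 1)) * (1 - (2 : ℝ)⁻¹ ^ 2 ^ L)) * e
      · exact two _ _ (by omega) (by omega)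
      · intro mp p E a X hmp hE hs ha0 ha1 hp hX
        exact (core mp p E a X hmp hE hs ha0 ha1 hp hX).2.2.2 (by omega) (by omega) _ hD
          (by omega) (by omega)

end Final

/-- Theorem 2.2: M_m(q) is the maximum of L_m,q(m', ℘) over all m' in 0..m and all
signed partitions ℘ of m - m'. -/
theorem Mm_eq_max_Lfun (f q m : ℕ) (hf : 1 ≤ f) (hq : q = 2 ^ f) (hm : 1 ≤ m) :
    IsGreatest {L : ℕ | ∃ mp ≤ m, ∃ P : List (ℕ × Bool),
      IsSignedPartition (m - mp) P ∧ Lfun q mp P = L} (Mm m q) := by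
  suffices h : Att q m (Mm m q) ∧ Up q m (Mm m q) by
    refine ⟨h.1, ?_⟩
    rintro x ⟨mp, hmp, P, hP, rfl⟩
    exact h.2 mp hmp P hP
  have hqe : Even q := by
    rw [hq]; exact (by decide : Even 2).pow_of_ne_zero (by omega)
  have hqp : 2 ≤ q := by
    rw [hq]
    exact (Nat.pow_le_pow_right (by norm_num) hf).trans' (by norm_num)
  by_cases hq2 : q = 2
  · clear hq
    subst hq2
    obtain ⟨L, m0, hL, hm0, hL1, hmL, hlt⟩ := spec_two m hm
    apply final_two m L m0 hL1 hmL hlt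
    unfold Mm
    simp only [hL, hm0, if_true]
  · have hq4 : 4 ≤ q := by
      obtain ⟨c, hc⟩ := hqe
      omega
    by_cases hmo : Odd m
    · have := final_odd q m hqe hq4 hmo
      unfold Mm
      rw [if_neg hq2, if_pos hmo]
      exact this
    · by_cases hm2 : m = 2
      · subst hm2
        unfold Mm
        rw [if_neg hq2, if_neg hmo, if_pos rfl]
        exact final_m2 q hqe hq4
      · have hme : Even m := Nat.not_odd_iff_even.1 hmo
        obtain ⟨L, hL, hL1, hL2, hL3⟩ := spec_four m (by
          obtain ⟨c, hc⟩ := hme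
          omega)
        unfold Mm
        rw [if_neg hq2, if_neg hmo, if_neg hm2]
        simp only [hL]
        exact final_even q m L hqe hq4 hme hL1 hL2 hL3
end

section
/- Let m ≥ 1 be an integer and let q be a power of 2. Then the symplectic group Sp_{2m}(q) contains an element g with |g| = M_m(q), where |g| denotes the order of g. -/
open Matrix in
/-- the symplectic group of `F` in dimension `2k` has an element of order `n`. -/
def HasOrd (F : Type) [Field F] (k n : ℕ) : Prop :=
  ∃ S ∈ Matrix.symplecticGroup (Fin k) F, orderOf S = n

theorem HasOrd.zero (F : Type) [Field F] : HasOrd F 0 1 :=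
  ⟨1, Submonoid.one_mem _, orderOf_one⟩

theorem HasOrd.toGroup {F : Type} [Field F] {k n : ℕ} (h : HasOrd F k n) :
    ∃ g : Matrix.symplecticGroup (Fin k) F, orderOf g = n := by
  obtain ⟨S, hS, ho⟩ := h
  exact ⟨⟨S, hS⟩, by rw [← ho, ← orderOf_submonoid]⟩

/-- block diagonal embedding -/
def diagHom (R : Type) [CommRing R] (a b : Type) [Fintype a] [Fintype b] [DecidableEq a]
    [DecidableEq b] : Matrix a a R × Matrix b b R →* Matrix (a ⊕ b) (a ⊕ b) R where
  toFun p := Matrix.fromBlocks p.1 0 0 p.2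
  map_one' := by simp
  map_mul' p r := by simp [Matrix.fromBlocks_multiply]

theorem diagHom_injective (R : Type) [CommRing R] (a b : Type) [Fintype a] [Fintype b]
    [DecidableEq a] [DecidableEq b] : Function.Injective (diagHom R a b) := by
  rintro ⟨p1, p2⟩ ⟨r1, r2⟩ h
  have := Matrix.fromBlocks_inj.1 h
  exact Prod.ext this.1 this.2.2.2

theorem HasOrd.reindex_aux {F : Type} [Field F] {l : Type} [Fintype l]
    [DecidableEq l] {X : Type} [Fintype X] [DecidableEq X]
    (e : X ≃ l ⊕ l) (S K : Matrix X X F) (hS : S * K * S.transpose = K)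
    (hK : Matrix.reindex e e K = Matrix.J l F) :
    Matrix.reindex e e S ∈ Matrix.symplecticGroup l F := by
  rw [SymplecticGroup.mem_iff, ← hK]
  have h := congrArg (Matrix.reindex e e) hS
  simp only [Matrix.reindex_apply] at h ⊢
  refine Eq.trans ?_ h
  simp [Matrix.submatrix_mul_equiv, Matrix.transpose_submatrix]

/-- rearrangement of index types -/
def rearr (a b : ℕ) : (Fin a ⊕ Fin a) ⊕ (Fin b ⊕ Fin b) ≃ Fin (a + b) ⊕ Fin (a + b) :=
  (Equiv.sumSumSumComm _ _ _ _).trans (Equiv.sumCongr finSumFinEquiv finSumFinEquiv)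

theorem HasOrd.mul {F : Type} [Field F] {a b m n : ℕ} (h1 : HasOrd F a m) (h2 : HasOrd F b n)
    (hc : Nat.Coprime m n) : HasOrd F (a + b) (m * n) := by
  obtain ⟨S, hS, ho⟩ := h1
  obtain ⟨T, hT, ho'⟩ := h2
  rw [SymplecticGroup.mem_iff] at hS hT
  refine ⟨Matrix.reindex (rearr a b) (rearr a b) (diagHom F _ _ (S, T)), ?_, ?_⟩
  · refine HasOrd.reindex_aux (rearr a b) _
      (diagHom F _ _ (Matrix.J (Fin a) F, Matrix.J (Fin b) F)) ?_ ?_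
    · simp [diagHom, Matrix.fromBlocks_multiply, Matrix.fromBlocks_transpose, hS, hT]
    · rw [← Equiv.eq_symm_apply]
      ext i j
      rcases i with (i | i) | (i | i) <;> rcases j with (j | j) | (j | j) <;>
      simp [diagHom, Matrix.J, rearr, Matrix.one_apply, Fin.ext_iff] <;> omega
  · have e1 := orderOf_injective
      (Matrix.reindexAlgEquiv F F (rearr a b)).toAlgHom.toRingHom.toMonoidHom
      (Matrix.reindexAlgEquiv F F (rearr a b)).injective (diagHom F _ _ (S, T))
    have e2 := orderOf_injective (diagHom F (Fin a ⊕ Fin a) (Fin b ⊕ Fin b))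
      (diagHom_injective _ _ _) (S, T)
    rw [Prod.orderOf] at e2
    simp only [ho, ho'] at e2
    rw [hc.lcm_eq_mul] at e2
    rw [← e2, ← e1]
    rfl

section SL2
variable {F E : Type} [Field F] [Field E] [Algebra F E] {k : ℕ}

/-- trace-form Gram matrix -/
noncomputable def gram (b : Module.Basis (Fin k) F E) : Matrix (Fin k) (Fin k) F :=
  (Algebra.traceForm F E).toMatrix b

theorem gram_symm (b : Module.Basis (Fin k) F E) : (gram b).transpose = gram b := by
  ext i j
  simp [gram, Algebra.traceForm_toMatrix, mul_comm, LinearMap.BilinForm.toMatrix_apply,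
    Algebra.traceForm_apply]

theorem gram_mul (b : Module.Basis (Fin k) F E) (x : E) :
    gram b * Algebra.leftMulMatrix b x = (Algebra.leftMulMatrix b x).transpose * gram b := by
  have key : ∀ (y : E) (i : Fin k) , (gram b).mulVec (b.repr y) i = Algebra.trace F E (b i * y) := by
    intro y i
    conv_rhs => rw [← b.sum_repr y]
    rw [Finset.mul_sum, map_sum, Matrix.mulVec, dotProduct]
    refine Finset.sum_congr rfl fun j _ => ?_
    rw [mul_smul_comm, map_smul, smul_eq_mul, mul_comm]
    simp [gram, LinearMap.BilinForm.toMatrix_apply, Algebra.traceForm_apply]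
  have h1 : ∀ i j, (gram b * Algebra.leftMulMatrix b x) i j = Algebra.trace F E (b i * (x * b j)) := by
    intro i j
    rw [← key]
    simp [Matrix.mul_apply, Matrix.mulVec, dotProduct, Algebra.leftMulMatrix_eq_repr_mul]
  have h2 : (Algebra.leftMulMatrix b x).transpose * gram b
      = (gram b * Algebra.leftMulMatrix b x).transpose := by
    rw [Matrix.transpose_mul, gram_symm]
  rw [h2]
  ext i j
  rw [Matrix.transpose_apply, h1, h1]
  congr 1
  ring

theorem gram_det [Algebra.IsSeparable F E] (b : Module.Basis (Fin k) F E) : IsUnit (gram b).det :=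
  isUnit_iff_ne_zero.2 (det_traceForm_ne_zero b)

/-- restriction of scalars from two by two matrices -/
noncomputable def resHom [Algebra.IsSeparable F E] (b : Module.Basis (Fin k) F E) :
    Matrix (Fin 2) (Fin 2) E →* Matrix (Fin k ⊕ Fin k) (Fin k ⊕ Fin k) F where
  toFun M := Matrix.fromBlocks (Algebra.leftMulMatrix b (M 0 0))
    (Algebra.leftMulMatrix b (M 0 1) * (gram b)⁻¹) (gram b * Algebra.leftMulMatrix b (M 1 0))
    (gram b * Algebra.leftMulMatrix b (M 1 1) * (gram b)⁻¹)
  map_one' := by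
    simp [Matrix.mul_nonsing_inv _ (gram_det b)]
  map_mul' M N := by
    have hc := fun (X : Matrix (Fin k) (Fin k) F) => Matrix.nonsing_inv_mul_cancel_left (A := gram b) X (gram_det b)
    rw [Matrix.fromBlocks_multiply]
    simp [Matrix.mul_apply, Fin.sum_univ_two, Matrix.mul_add, Matrix.add_mul, Matrix.mul_assoc, hc]

theorem resHom_injective [Algebra.IsSeparable F E] (b : Module.Basis (Fin k) F E) :
    Function.Injective (resHom b) := by
  intro M N h
  obtain ⟨h1, h2, h3, h4⟩ := Matrix.fromBlocks_inj.1 h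
  have hi := Algebra.leftMulMatrix_injective b
  have hr : ∀ X Y : Matrix (Fin k) (Fin k) F, X * (gram b)⁻¹ = Y * (gram b)⁻¹ → X = Y := by
    intro X Y h
    rw [← Matrix.nonsing_inv_mul_cancel_right (A := gram b) X (gram_det b), h,
      Matrix.nonsing_inv_mul_cancel_right (A := gram b) Y (gram_det b)]
  have hl : ∀ X Y : Matrix (Fin k) (Fin k) F, (gram b) * X = (gram b) * Y → X = Y := by
    intro X Y h
    rw [← Matrix.nonsing_inv_mul_cancel_left (A := gram b) X (gram_det b), h,
      Matrix.nonsing_inv_mul_cancel_left (A := gram b) Y (gram_det b)]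
  ext i j
  fin_cases i <;> fin_cases j
  · exact hi h1
  · exact hi (hr _ _ h2)
  · exact hi (hl _ _ h3)
  · exact hi (hl _ _ (hr _ _ h4))

theorem resHom_mem [Algebra.IsSeparable F E] (b : Module.Basis (Fin k) F E)
    (M : Matrix (Fin 2) (Fin 2) E) (hM : M.det = 1) :
    resHom b M ∈ Matrix.symplecticGroup (Fin k) F := by
  have hu := gram_det b
  have hgi : (gram b)⁻¹.transpose = (gram b)⁻¹ := by
    rw [Matrix.transpose_nonsing_inv, gram_symm]
  have hT : ∀ x, (Algebra.leftMulMatrix b x).transpose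
      = gram b * Algebra.leftMulMatrix b x * (gram b)⁻¹ := by
    intro x
    rw [gram_mul, Matrix.mul_nonsing_inv_cancel_right _ _ hu]
  have hc := fun (X : Matrix (Fin k) (Fin k) F) =>
    Matrix.nonsing_inv_mul_cancel_left (A := gram b) X hu
  have hc2 := Matrix.nonsing_inv_mul (gram b) hu
  have hd : M 0 0 * M 1 1 - M 0 1 * M 1 0 = 1 := by rw [← hM, Matrix.det_fin_two]
  rw [SymplecticGroup.mem_iff]
  simp only [resHom, MonoidHom.coe_mk, OneHom.coe_mk, Matrix.J, Matrix.fromBlocks_multiply,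
    Matrix.fromBlocks_transpose, Matrix.transpose_mul, hgi, gram_symm, hT]
  simp only [Matrix.mul_assoc, hc, hc2, Matrix.mul_zero, Matrix.zero_mul, zero_add, add_zero,
    Matrix.mul_one, Matrix.mul_neg, Matrix.neg_mul, Matrix.one_mul]
  have hL : ∀ x y, Algebra.leftMulMatrix b x * Algebra.leftMulMatrix b y
    = Algebra.leftMulMatrix b (x * y) := fun x y => (map_mul _ _ _).symm
  have hL' : ∀ x y Z, Algebra.leftMulMatrix b x * (Algebra.leftMulMatrix b y * Z)
    = Algebra.leftMulMatrix b (x * y) * Z := fun x y Z => by rw [← Matrix.mul_assoc, hL]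
  simp only [hL, hL']
  have e1 : M 0 0 * M 1 1 = 1 + M 0 1 * M 1 0 := by linear_combination hd
  have e2 : M 1 1 * M 0 0 = 1 + M 0 1 * M 1 0 := by linear_combination hd
  rw [mul_comm (M 0 1) (M 0 0), mul_comm (M 1 0) (M 0 1), e1, e2, mul_comm (M 1 0) (M 1 1)]
  simp [Matrix.mul_add, Matrix.add_mul, Matrix.mul_nonsing_inv _ hu]

theorem HasOrd.of_sl2 [Algebra.IsSeparable F E] (b : Module.Basis (Fin k) F E)
    (M : Matrix (Fin 2) (Fin 2) E) (hM : M.det = 1) : HasOrd F k (orderOf M) :=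
  ⟨resHom b M, resHom_mem b M hM, orderOf_injective _ (resHom_injective b) M⟩

end SL2

/-- diagonal elements of `SL_2` -/
noncomputable def torusHom (E : Type) [Field E] : Eˣ →* Matrix (Fin 2) (Fin 2) E where
  toFun x := Matrix.diagonal ![(x : E), ((x⁻¹ : Eˣ) : E)]
  map_one' := by ext i j; fin_cases i <;> fin_cases j <;> simp
  map_mul' x y := by
    ext i j
    fin_cases i <;> fin_cases j <;> simp [mul_comm]

theorem HasOrd.split {F : Type} [Field F] [Fintype F] [CharP F 2] (k : ℕ) (hk : 1 ≤ k) :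
    HasOrd F k (Fintype.card F ^ k - 1) := by
  have : NeZero k := ⟨by omega⟩
  let E := FiniteField.Extension F 2 k
  let b : Module.Basis (Fin k) F E :=
    Module.finBasisOfFinrankEq F E (FiniteField.finrank_extension F 2 k)
  obtain ⟨g, hg⟩ := IsCyclic.exists_generator (α := Eˣ)
  have ho : orderOf g = Fintype.card F ^ k - 1 := by
    rw [orderOf_eq_card_of_forall_mem_zpowers hg, Nat.card_units, FiniteField.natCard_extension,
      Nat.card_eq_fintype_card]
  have := HasOrd.of_sl2 b (torusHom E g) (by simp [torusHom])
  rw [orderOf_injective] at this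
  · rwa [ho] at this
  · intro x y h
    have := congrFun (congrFun h 0) 0
    simpa [torusHom, Units.ext_iff] using this

theorem HasOrd.nonsplit {F : Type} [Field F] [Fintype F] [CharP F 2] (k : ℕ) (hk : 1 ≤ k) :
    HasOrd F k (Fintype.card F ^ k + 1) := by
  have : NeZero k := ⟨by omega⟩
  let E := FiniteField.Extension F 2 k
  have : CharP E 2 := charP_of_injective_algebraMap (algebraMap F E).injective 2
  let b : Module.Basis (Fin k) F E :=
    Module.finBasisOfFinrankEq F E (FiniteField.finrank_extension F 2 k)
  let K := FiniteField.Extension E 2 2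
  let c : Module.Basis (Fin 2) E K :=
    Module.finBasisOfFinrankEq E K (FiniteField.finrank_extension E 2 2)
  have hE : Nat.card E = Fintype.card F ^ k := by
    rw [FiniteField.natCard_extension, Nat.card_eq_fintype_card]
  have hK : Nat.card K = Nat.card E ^ 2 := FiniteField.natCard_extension _ _ _
  have h1 : 1 < Nat.card E := Finite.one_lt_card
  set Q := Nat.card E with hQ
  have hf : Nat.card K - 1 = (Q - 1) * (Q + 1) := by
    rw [hK]
    zify [h1.le, Nat.one_le_pow 2 Q (by omega)]
    ring
  have hdiv : (Nat.card K - 1) / (Q - 1) = Q + 1 := by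
    rw [hf, Nat.mul_div_cancel_left _ (by omega)]
  obtain ⟨g, hg⟩ := IsCyclic.exists_generator (α := Kˣ)
  have ho : orderOf g = (Q - 1) * (Q + 1) := by
    rw [orderOf_eq_card_of_forall_mem_zpowers hg, Nat.card_units, hf]
  have ho2 : orderOf (g ^ (Q - 1)) = Q + 1 := by
    rw [orderOf_pow_of_dvd (by omega) (by rw [ho]; exact dvd_mul_right _ _), ho,
      Nat.mul_div_cancel_left _ (by omega)]
  have ho3 : orderOf ((g ^ (Q - 1) : Kˣ) : K) = Q + 1 := by rw [orderOf_units, ho2]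
  set z : K := ((g ^ (Q - 1) : Kˣ) : K) with hz
  have hn : Algebra.norm E z = 1 := by
    apply (algebraMap E K).injective
    rw [FiniteField.algebraMap_norm_eq_pow, hdiv, ← ho3, pow_orderOf_eq_one, map_one]
  have := HasOrd.of_sl2 b (Algebra.leftMulMatrix c z) (by rw [← Algebra.norm_eq_matrix_det, hn])
  have e := orderOf_injective (Algebra.leftMulMatrix c).toRingHom.toMonoidHom
    (Algebra.leftMulMatrix_injective c) z
  rw [ho3, hE] at e
  rw [← e]
  exact this

section Unip

theorem HasOrd.of_zmod {F : Type} [Field F] [CharP F 2] {k n : ℕ} (h : HasOrd (ZMod 2) k n) :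
    HasOrd F k n := by
  obtain ⟨S, hS, ho⟩ := h
  let φ : ZMod 2 →+* F := ZMod.castHom (dvd_refl 2) F
  rw [SymplecticGroup.mem_iff] at hS
  refine ⟨S.map φ, ?_, ?_⟩
  · rw [SymplecticGroup.mem_iff]
    have := congrArg (fun X => Matrix.map X φ) hS
    simpa [Matrix.map_mul, Matrix.transpose_map] using this
  · rw [← ho]
    exact orderOf_injective φ.mapMatrix.toMonoidHom (Matrix.map_injective φ.injective) S

theorem HasOrd.unip_one : HasOrd (ZMod 2) 1 2 := by
  refine ⟨Matrix.fromBlocks 1 1 0 1, ?_, ?_⟩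
  · rw [SymplecticGroup.mem_iff]; decide +kernel
  · exact orderOf_eq_prime_pow (p := 2) (n := 0) (by decide +kernel) (by decide +kernel)

theorem HasOrd.unip_two : HasOrd (ZMod 2) 2 4 := by
  refine ⟨Matrix.fromBlocks !![1, 1; 0, 1] !![0, 1; 0, 1] 0 !![1, 0; 1, 1], ?_, ?_⟩
  · rw [SymplecticGroup.mem_iff]; decide +kernel
  · exact orderOf_eq_prime_pow (p := 2) (n := 1) (by decide +kernel) (by decide +kernel)

theorem HasOrd.unip_three : HasOrd (ZMod 2) 3 8 := by
  refine ⟨Matrix.fromBlocks !![1, 1, 0; 0, 1, 1; 0, 0, 1] !![0, 0, 0; 0, 0, 1; 0, 0, 1] 0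
    !![1, 0, 0; 1, 1, 0; 1, 1, 1], ?_, ?_⟩
  · rw [SymplecticGroup.mem_iff]; decide +kernel
  · refine orderOf_eq_prime_pow (p := 2) (n := 2) ?_ ?_
    · rw [show 2 ^ 2 = 2 * 2 from rfl, pow_mul, pow_two, pow_two]
      decide +kernel
    · rw [show 2 ^ (2 + 1) = 2 * 2 * 2 from rfl, pow_mul, pow_mul, pow_two, pow_two, pow_two]
      decide +kernel

end Unip

theorem no_bad_prime {q n p : ℕ} (hp : p.Prime) (hq : Even q) (hn : n ≠ 0) (hd : p ∣ q ^ n + 1)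
    (h : (1 : ZMod p) = -1) : False := by
  have h2 : ((2 : ℕ) : ZMod p) = 0 := by push_cast; linear_combination h
  rw [ZMod.natCast_eq_zero_iff] at h2
  have h3 : p = 2 := (Nat.prime_dvd_prime_iff_eq hp Nat.prime_two).1 h2
  subst h3
  have : Even (q ^ n) := hq.pow_of_ne_zero hn
  rw [even_iff_two_dvd] at this
  omega

theorem neg_one_of_dvd {p x : ℕ} (h : p ∣ x + 1) : (x : ZMod p) = -1 := by
  rw [← ZMod.natCast_eq_zero_iff] at h
  push_cast at h
  linear_combination h

theorem cop_lt {q i j : ℕ} (hq : Even q) (hij : i < j) :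
    Nat.Coprime (q ^ 2 ^ i + 1) (q ^ 2 ^ j + 1) := by
  refine Nat.coprime_of_dvd fun p hp h1 h2 => ?_
  have e1 := neg_one_of_dvd h1
  have e2 := neg_one_of_dvd h2
  push_cast at e1 e2
  refine no_bad_prime hp hq (by positivity) h1 ?_
  rw [← e2, show j = i + (j - i) by omega, pow_add 2, pow_mul, e1]
  exact (Even.neg_one_pow ((even_two).pow_of_ne_zero (by omega))).symm

theorem cop_ne {q i j : ℕ} (hq : Even q) (hij : i ≠ j) :
    Nat.Coprime (q ^ 2 ^ i + 1) (q ^ 2 ^ j + 1) := by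
  rcases lt_or_gt_of_ne hij with h | h
  · exact cop_lt hq h
  · exact (cop_lt hq h).symm

theorem cop_split {q k i : ℕ} (hq0 : 0 < q) (hq : Even q) (hk : Odd k) :
    Nat.Coprime (q ^ k - 1) (q ^ 2 ^ i + 1) := by
  refine Nat.coprime_of_dvd fun p hp h1 h2 => ?_
  have e2 := neg_one_of_dvd h2
  have e1 : (q : ZMod p) ^ k = 1 := by
    rw [← ZMod.natCast_eq_zero_iff, Nat.cast_sub (Nat.one_le_pow _ _ hq0)] at h1
    push_cast at h1
    linear_combination h1
  push_cast at e2
  refine no_bad_prime hp hq (by positivity) h2 ?_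
  calc (1 : ZMod p) = ((q : ZMod p) ^ k) ^ 2 ^ i := by rw [e1, one_pow]
    _ = ((q : ZMod p) ^ 2 ^ i) ^ k := by rw [← pow_mul, ← pow_mul, mul_comm]
    _ = -1 := by rw [e2, hk.neg_one_pow]

/-- product of the first generalized Fermat numbers -/
def fprod (q L : ℕ) : ℕ := ∏ i ∈ Finset.range L, (q ^ 2 ^ i + 1)

theorem fprod_mul {q : ℕ} (hq : 0 < q) (L : ℕ) : fprod q L * (q - 1) = q ^ 2 ^ L - 1 := by
  induction L with
  | zero => simp [fprod]
  | succ n ih =>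
    unfold fprod at ih ⊢
    rw [Finset.prod_range_succ, mul_right_comm, ih, mul_comm, pow_succ 2, pow_mul]
    zify [Nat.one_le_pow (2 ^ n) q hq, Nat.one_le_pow 2 (q ^ 2 ^ n) (by positivity)]
    ring

theorem fprod_two (L : ℕ) : fprod 2 L = 2 ^ 2 ^ L - 1 := by
  simpa using fprod_mul (q := 2) (by norm_num) L

section Main
variable {F : Type} [Field F] [Fintype F] [CharP F 2]

theorem HasOrd.set {q : ℕ} (hF : Fintype.card F = q) (hq : Even q) (s : Finset ℕ) :
    HasOrd F (∑ i ∈ s, 2 ^ i) (∏ i ∈ s, (q ^ 2 ^ i + 1)) := by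
  classical
  induction s using Finset.induction_on with
  | empty => simpa using HasOrd.zero F
  | insert a s ha ih =>
    rw [Finset.sum_insert ha, Finset.prod_insert ha]
    refine HasOrd.mul ?_ ih ?_
    · rw [← hF]
      exact HasOrd.nonsplit _ (Nat.one_le_two_pow)
    · refine Nat.Coprime.prod_right fun i hi => cop_ne hq ?_
      rintro rfl
      exact ha hi

theorem HasOrd.fprod {q : ℕ} (hF : Fintype.card F = q) (hq : Even q) (L : ℕ) :
    HasOrd F (2 ^ L - 1) (fprod q L) := by
  have := HasOrd.set hF hq (Finset.range L)
  rwa [Nat.geomSum_eq le_rfl, Nat.div_one] at this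

theorem HasOrd.split_fprod {q : ℕ} (hF : Fintype.card F = q) (hq : Even q) (k L : ℕ)
    (hk : Odd k) : HasOrd F (k + (2 ^ L - 1)) ((q ^ k - 1) * _root_.fprod q L) := by
  have hq0 : 0 < q := hF ▸ Fintype.card_pos
  refine HasOrd.mul ?_ (HasOrd.fprod hF hq L) ?_
  · rw [← hF]; exact HasOrd.split _ hk.pos
  · exact Nat.Coprime.prod_right fun i hi => cop_split hq0 hq hk

theorem fprod_coprime_two {q : ℕ} (hq : Even q) (L : ℕ) : Nat.Coprime 2 (fprod q L) := by
  refine Nat.Coprime.prod_right fun i hi => ?_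
  rw [Nat.coprime_two_left]
  exact (hq.pow_of_ne_zero (by positivity)).add_one

theorem odd_pow_sub_one {k : ℕ} (hk : k ≠ 0) : Nat.Coprime 2 (2 ^ k - 1) := by
  rw [Nat.coprime_two_left]
  exact Nat.Even.sub_odd Nat.one_le_two_pow (even_two.pow_of_ne_zero hk) odd_one

theorem HasOrd.congr {k n k' n' : ℕ} (h : HasOrd F k n) (hk : k = k') (hn : n = n') :
    HasOrd F k' n' := hk ▸ hn ▸ h

theorem HasOrd.two_split_fprod (hF : Fintype.card F = 2) (k L : ℕ)
    (hk : Odd k) : HasOrd F (1 + (k + (2 ^ L - 1))) (2 * ((2 ^ k - 1) * _root_.fprod 2 L)) := by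
  refine HasOrd.mul (HasOrd.of_zmod HasOrd.unip_one) (HasOrd.split_fprod hF even_two k L hk) ?_
  exact Nat.Coprime.mul_right (odd_pow_sub_one hk.pos.ne') (fprod_coprime_two even_two L)

theorem main_two (hF : Fintype.card F = 2) (m : ℕ) (hm : 1 ≤ m) : HasOrd F m (Mm m 2) := by
  unfold Mm
  rw [if_pos rfl]
  dsimp only
  set L := Nat.findGreatest (fun l => 0 < l ∧ 2 ^ l - 1 ≤ m) m
  set m0 := m - (2 ^ L - 1)
  have hL : 0 < L ∧ 2 ^ L - 1 ≤ m :=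
    Nat.findGreatest_spec (P := fun l => 0 < l ∧ 2 ^ l - 1 ≤ m) (m := 1) hm (by simpa using hm)
  obtain ⟨hL0, hLm⟩ := hL
  have hm0 : m = m0 + (2 ^ L - 1) := by omega
  have hdbl : 2 ^ L = 2 ^ (L - 1) + 2 ^ (L - 1) := by
    rw [← two_mul, ← pow_succ', Nat.sub_add_cancel hL0]
  have hpos : 0 < 2 ^ (L - 1) := by positivity
  clear_value L m0
  split_ifs with h1 h2 h3 h4 h5
  · have hb := HasOrd.fprod hF even_two L
    have hu : HasOrd (ZMod 2) m0 (2 ^ m0) := by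
      interval_cases m0
      · exact HasOrd.zero _
      · exact HasOrd.unip_one
      · exact HasOrd.unip_two
      · exact HasOrd.unip_three
    refine (HasOrd.mul (HasOrd.of_zmod hu) hb ?_).congr hm0.symm (by rw [fprod_two])
    exact (fprod_coprime_two even_two L).pow_left _
  · have hev : Even (2 ^ (L - 1)) := even_two.pow_of_ne_zero (by
      intro h; rw [h] at h2; omega)
    exact (HasOrd.split_fprod hF even_two (2 ^ (L - 1) + m0) (L - 1) (hev.add_odd h3)).congr
      (by omega) (by rw [fprod_two])
  · have hev : Even (2 ^ (L - 1)) := even_two.pow_of_ne_zero (by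
      intro h; rw [h] at h2; omega)
    have ho : Odd (2 ^ (L - 1) + m0 - 1) :=
      Nat.Even.sub_odd (by omega) (hev.add (Nat.not_odd_iff_even.1 h3)) odd_one
    exact (HasOrd.two_split_fprod hF _ (L - 1) ho).congr
      (by omega) (by rw [fprod_two, mul_assoc])
  · have hx := HasOrd.nonsplit (F := F) (2 ^ L) (by omega)
    rw [hF] at hx
    refine (hx.mul (HasOrd.fprod hF even_two (L - 1)) ?_).congr (by omega) (by rw [fprod_two])
    refine Nat.Coprime.prod_right fun i hi => cop_ne even_two ?_
    rw [Finset.mem_range] at hi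
    omega
  · exact (HasOrd.split_fprod hF even_two m0 L h5).congr hm0.symm (by rw [fprod_two])
  · have ho : Odd (m0 - 1) := Nat.Even.sub_odd (by omega) (Nat.not_odd_iff_even.1 h5) odd_one
    exact (HasOrd.two_split_fprod hF _ L ho).congr (by omega) (by rw [fprod_two, mul_assoc])

theorem main_gt {q : ℕ} (hF : Fintype.card F = q) (hq : Even q) (hq2 : q ≠ 2) (m : ℕ)
    (hm : 1 ≤ m) : HasOrd F m (Mm m q) := by
  have hq1 : 1 < q := hF ▸ Fintype.one_lt_card
  unfold Mm
  rw [if_neg hq2]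
  split_ifs with h1 h2
  · have := HasOrd.set hF hq m.bitIndices.toFinset
    refine this.congr (by simp) ?_
    rw [← Finset.prod_filter]
    refine Finset.prod_congr ?_ fun _ _ => rfl
    ext i
    simp only [List.mem_toFinset, Nat.mem_bitIndices, Finset.mem_filter, Finset.mem_range]
    refine ⟨fun h => ⟨?_, h⟩, fun h => h.2⟩
    have a := Nat.two_pow_le_of_mem_bitIndices (Nat.mem_bitIndices.2 h)
    have b := Nat.lt_two_pow_self (n := i)
    omega
  · subst h2
    rw [← hF]
    exact HasOrd.nonsplit 2 (by norm_num)
  · dsimp only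
    set L := Nat.findGreatest (fun l => 0 < l ∧ 2 ^ l + 2 ^ (l - 1) ≤ m) m
    have hev := Nat.not_odd_iff_even.1 h1
    have hm4 : 4 ≤ m := by obtain ⟨r, hr⟩ := hev; omega
    have hL : 0 < L ∧ 2 ^ L + 2 ^ (L - 1) ≤ m :=
      Nat.findGreatest_spec (P := fun l => 0 < l ∧ 2 ^ l + 2 ^ (l - 1) ≤ m) (m := 1) hm
        (by simp; omega)
    obtain ⟨hL0, hLm⟩ := hL
    clear_value L
    have hp : 0 < 2 ^ L := by positivity
    have hp2 : 2 ^ L ≤ m := le_trans (Nat.le_add_right _ _) hLm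
    have hdim : m - 2 ^ L + 1 + (2 ^ L - 1) = m := by
      generalize 2 ^ L = x at hp hp2
      omega
    have ho : Odd (m - 2 ^ L + 1) := by
      apply Even.add_one
      exact (Nat.even_sub hp2).2 (by simp [hev, Nat.even_pow, hL0.ne'])
    refine (HasOrd.split_fprod hF hq _ L ho).congr hdim ?_
    rw [← fprod_mul (by omega) L, ← mul_assoc, Nat.mul_div_cancel _ (by omega)]

end Main

/-- The symplectic group Sp_2m(q), q even, contains an element of order M_m(q). -/
theorem exists_elt_of_order_Mm (f q m : ℕ) (hf : 1 ≤ f) (hq : q = 2 ^ f) (hm : 1 ≤ m)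
    (F : Type) [Field F] [Fintype F] (hF : Fintype.card F = q) :
    ∃ g : Matrix.symplecticGroup (Fin m) F, orderOf g = Mm m q := by
  have hc : CharP F 2 := by
    have h0 : ((2 ^ f : ℕ) : F) = 0 := by rw [← hq, ← hF]; exact FiniteField.cast_card_eq_zero F
    push_cast at h0
    have h2 : (2 : F) = 0 := eq_zero_of_pow_eq_zero h0
    exact CharTwo.of_one_ne_zero_of_two_eq_zero one_ne_zero h2
  apply HasOrd.toGroup
  by_cases h : q = 2
  · subst h
    exact main_two hF m hm
  · exact main_gt hF (hq ▸ even_two.pow_of_ne_zero (by omega)) h m hm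
end
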